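/- Let R be a commutative Noetherian ring of finite Krull dimension d ≥ 1 and let A be a geometric subring of R[T]. Let M be a finitely generated A-module such that μ_p(M) ≥ dim(A/p) for every minimal prime ideal p of A. Then M has a basic element. -/

import Mathlib

open Polynomial

/-- The minimal number of generators of an `R`-module `M`. -/
noncomputable def minNumGens (R M : Type*) [CommRing R] [AddCommGroup M] [Module R M] : ℕ :=
  sInf {n : ℕ | ∃ s : Finset M, s.card = n ∧ Submodule.span R (s : Set M) = ⊤}

/-- `μ_p(M)`: the minimal number of generators of the localization `M_p` over `R_p`. -/
noncomputable def muP {R : Type*} [CommRing R] (p : Ideal R) (hp : p.IsPrime)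
    (M : Type*) [AddCommGroup M] [Module R M] : ℕ :=
  letI := hp
  minNumGens (Localization p.primeCompl) (LocalizedModule p.primeCompl M)

/-- `x` is a basic element of `M` at the prime `p` : the image of `x` in `M_p` does not lie in
`p M_p`. -/
def IsBasicAt {R M : Type*} [CommRing R] [AddCommGroup M] [Module R M]
    (x : M) (p : Ideal R) (hp : p.IsPrime) : Prop :=
  letI := hp
  LocalizedModule.mkLinearMap p.primeCompl M x ∉
    (p.map (algebraMap R (Localization p.primeCompl))) •
      (⊤ : Submodule (Localization p.primeCompl) (LocalizedModule p.primeCompl M))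

/-- `A` is a geometric subring of `R[T]`, where `d = dim R`: `A` is a Noetherian subring of `R[T]`
containing `R`, there is a non-zero divisor `s ∈ R` with `A_s = R_s[T]` (equivalently, every
polynomial is carried into `A` by a power of `s`), and `dim A = d + 1`. -/
def IsGeometricSubring {R : Type*} [CommRing R] (A : Subalgebra R (Polynomial R)) (d : ℕ) : Prop :=
  IsNoetherianRing A ∧
  (∃ s : R, s ∈ nonZeroDivisors R ∧ ∀ f : Polynomial R, ∃ k : ℕ, (C s) ^ k * f ∈ A) ∧
  ringKrullDim A = (d + 1 : ℕ)

open scoped TensorProduct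

section EisenbudEvans

variable {A : Type*} [CommRing A] {M : Type*} [AddCommGroup M] [Module A M]

/-- Clearing denominators in linear maps from a finite module. -/
lemma exists_smul_mem_of_finite [Module.Finite A M] {L : Type*} [AddCommGroup L] [Module A L]
    (N : Submodule A L) (S : Submonoid A) (hS : ∀ l : L, ∃ c ∈ S, c • l ∈ N) (ψ : M →ₗ[A] L) :
    ∃ c ∈ S, ∀ m, c • ψ m ∈ N := by
  classical
  obtain ⟨t, ht⟩ := Module.Finite.fg_top (R := A) (M := M)
  choose d hd hdN using hS
  refine ⟨∏ x ∈ t, d (ψ x), S.prod_mem fun x _ => hd _, fun m => ?_⟩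
  have hm : m ∈ Submodule.span A (t : Set M) := by rw [ht]; trivial
  induction hm using Submodule.span_induction with
  | mem x hx =>
    rw [← Finset.prod_erase_mul _ _ (Finset.mem_coe.1 hx), mul_smul]
    exact N.smul_mem _ (hdN _)
  | zero => simp
  | add x y _ _ hx hy => rw [map_add, smul_add]; exact N.add_mem hx hy
  | smul a x _ hx => rw [map_smul, smul_comm]; exact N.smul_mem _ hx

lemma exists_smul_mem_of_finite_family [Module.Finite A M] {L : Type*} [AddCommGroup L]
    [Module A L] (N : Submodule A L) (S : Submonoid A) (hS : ∀ l : L, ∃ c ∈ S, c • l ∈ N)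
    {ι : Type*} [Finite ι] (ψ : ι → M →ₗ[A] L) :
    ∃ c ∈ S, ∀ i m, c • ψ i m ∈ N := by
  classical
  have := Fintype.ofFinite ι
  choose d hd hdN using fun i => exists_smul_mem_of_finite N S hS (ψ i)
  refine ⟨∏ i, d i, S.prod_mem fun i _ => hd i, fun i m => ?_⟩
  rw [← Finset.prod_erase_mul _ _ (Finset.mem_univ i), mul_smul]
  exact N.smul_mem _ (hdN i m)

/-- Functionals on a finite module with values in an algebra `L` that is a localization of `A ⧸ p`
become, after multiplication by a denominator, functionals with values in `A ⧸ p`. -/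
lemma exists_functional [Module.Finite A M] {L : Type*} [CommRing L] [Algebra A L] (p : Ideal A)
    (hp : RingHom.ker (algebraMap A L) = p) (S : Submonoid A)
    (hS : ∀ l : L, ∃ c ∈ S, ∃ a, algebraMap A L a = c • l)
    {ι : Type*} [Finite ι] (ψ : ι → M →ₗ[A] L) :
    ∃ c ∈ S, ∃ φ : ι → M →ₗ[A] A ⧸ p, ∀ i m a,
      φ i m = Ideal.Quotient.mk p a ↔ algebraMap A L a = c • ψ i m := by
  obtain ⟨c, hc, h⟩ := exists_smul_mem_of_finite_family
    (LinearMap.range (Algebra.linearMap A L)) S (fun l => by simpa using hS l) ψ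
  choose g hg using h
  simp only [Algebra.linearMap_apply] at hg
  have key : ∀ a b, Ideal.Quotient.mk p a = Ideal.Quotient.mk p b ↔
      algebraMap A L a = algebraMap A L b := fun a b => by
    rw [Ideal.Quotient.eq, ← hp, RingHom.mem_ker, map_sub, sub_eq_zero]
  refine ⟨c, hc, fun i =>
    { toFun := fun m => Ideal.Quotient.mk p (g i m)
      map_add' := fun x y => ?_
      map_smul' := fun a x => ?_ }, fun i m a => ?_⟩
  · rw [← map_add, key]; simp [hg]
  · rw [RingHom.id_apply, Algebra.smul_def, Ideal.Quotient.algebraMap_eq, ← map_mul, key]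
    simp [hg, Algebra.smul_def]; ring
  · simp only [LinearMap.coe_mk, AddHom.coe_mk]
    rw [key, hg, eq_comm]

/-- The functional on the fibre at `P` induced by a functional with values in `A ⧸ p`,
where `p ≤ P`. -/
noncomputable def fiberFunctional {p P : Ideal A} [P.IsPrime] (h : p ≤ P) (φ : M →ₗ[A] A ⧸ p) :
    P.ResidueField ⊗[A] M →ₗ[P.ResidueField] P.ResidueField :=
  LinearMap.liftBaseChange P.ResidueField
    (((Algebra.linearMap (A ⧸ P) P.ResidueField).restrictScalars A) ∘ₗ
      (Ideal.Quotient.factorₐ A h).toLinearMap ∘ₗ φ)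

lemma fiberFunctional_one_tmul {p P : Ideal A} [P.IsPrime] (h : p ≤ P) (φ : M →ₗ[A] A ⧸ p)
    {m : M} {a : A} (hm : φ m = Ideal.Quotient.mk p a) :
    fiberFunctional h φ (1 ⊗ₜ m) = algebraMap A P.ResidueField a := by
  simp [fiberFunctional, hm]

/-- The dimension of the span of the images of a family in the fibre at `P`. -/
noncomputable def fiberRank {ι : Type*} (P : Ideal A) [P.IsPrime] (m : ι → M) : ℕ :=
  Set.finrank P.ResidueField (Set.range fun i => (1 : P.ResidueField) ⊗ₜ[A] m i)

lemma exists_smul_eq_algebraMap_residueField (p : Ideal A) [p.IsPrime] (l : p.ResidueField) :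
    ∃ c ∈ p.primeCompl, ∃ a, algebraMap A p.ResidueField a = c • l := by
  obtain ⟨a, b, hb, rfl⟩ := IsFractionRing.div_surjective (A := A ⧸ p) l
  obtain ⟨a, rfl⟩ := Ideal.Quotient.mk_surjective a
  obtain ⟨b, rfl⟩ := Ideal.Quotient.mk_surjective b
  have hb' : b ∉ p := fun h => nonZeroDivisors.ne_zero hb (Ideal.Quotient.eq_zero_iff_mem.2 h)
  refine ⟨b, hb', a, ?_⟩
  have : algebraMap A p.ResidueField b ≠ 0 := by
    rwa [Ne, Ideal.algebraMap_residueField_eq_zero]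
  rw [Algebra.smul_def]
  simp only [Ideal.algebraMap_quotient_residueField_mk]
  field_simp

lemma exists_fiberRank_le [Module.Finite A M] {ι : Type*} [Finite ι] (p : Ideal A) [p.IsPrime]
    (m : ι → M) :
    ∃ f ∉ p, ∀ (P : Ideal A) [P.IsPrime], p ≤ P → f ∉ P → fiberRank p m ≤ fiberRank P m := by
  classical
  obtain ⟨b, hb, hspan, hli⟩ := exists_linearIndependent p.ResidueField
    (Set.range fun i => (1 : p.ResidueField) ⊗ₜ[A] m i)
  have : Finite b := (Set.finite_range _).subset hb
  have := Fintype.ofFinite b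
  choose σ hσ using fun x : b => hb x.2
  obtain ⟨g, hg⟩ := LinearMap.exists_leftInverse_of_injective _
    (LinearMap.ker_eq_bot.2 hli)
  obtain ⟨c, hc, φ, hφ⟩ := exists_functional p p.ker_algebraMap_residueField p.primeCompl
    (exists_smul_eq_algebraMap_residueField p)
    (fun i : b => (((Finsupp.lapply i).comp g).restrictScalars A).comp
      (TensorProduct.mk A p.ResidueField M 1))
  have hval : ∀ i j, φ i (m (σ j)) = Ideal.Quotient.mk p (if i = j then c else 0) := by
    intro i j
    rw [hφ]
    have h1 := LinearMap.congr_fun hg (Finsupp.single j 1)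
    simp only [LinearMap.comp_apply, Finsupp.linearCombination_single, one_smul,
      LinearMap.id_apply] at h1
    simp only [LinearMap.comp_apply, LinearMap.restrictScalars_apply, TensorProduct.mk_apply, hσ,
      h1, Finsupp.lapply_apply, Finsupp.single_apply, Algebra.smul_def]
    by_cases hij : i = j
    · subst hij; simp
    · simp [hij, Ne.symm hij]
  refine ⟨c, hc, fun P _ hpP hcP => ?_⟩
  have hli' : LinearIndependent P.ResidueField
      (fun j : b => (1 : P.ResidueField) ⊗ₜ[A] m (σ j)) := by
    rw [Fintype.linearIndependent_iff]
    intro t ht i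
    have := congrArg (fiberFunctional hpP (φ i)) ht
    simp only [map_sum, map_smul, map_zero, fiberFunctional_one_tmul hpP _ (hval i _)] at this
    rw [Finset.sum_eq_single i (fun j _ hj => by simp [hj.symm]) (by simp)] at this
    simpa [Ideal.algebraMap_residueField_eq_zero, hcP] using this
  have h1 : fiberRank p m = Fintype.card b := by
    rw [fiberRank, Set.finrank, ← hspan, ← finrank_span_eq_card hli, Subtype.range_coe]
  rw [h1, ← finrank_span_eq_card hli', fiberRank, Set.finrank]
  have : Module.Finite P.ResidueField (Submodule.span P.ResidueField
    (Set.range fun i => (1 : P.ResidueField) ⊗ₜ[A] m i)) := .span_of_finite _ (Set.finite_range _)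
  refine Submodule.finrank_mono (Submodule.span_mono ?_)
  rintro _ ⟨j, rfl⟩
  exact ⟨σ j, rfl⟩

end EisenbudEvans

section PrimeAvoidance

variable {A : Type*} [CommRing A]

/-- An element of all the primes in a finite set which avoids a given prime containing none of
them. -/
lemma exists_mem_forall_notMem (F : Finset (PrimeSpectrum A)) (P : PrimeSpectrum A)
    (h : ∀ Q ∈ F, ¬ Q ≤ P) : ∃ c ∉ P.asIdeal, ∀ Q ∈ F, c ∈ Q.asIdeal := by
  by_contra! hc
  have : F.inf PrimeSpectrum.asIdeal ≤ P.asIdeal := fun c hcF => by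
    by_contra hcP
    obtain ⟨Q, hQ, hcQ⟩ := hc c hcP
    exact hcQ (Finset.inf_le (f := PrimeSpectrum.asIdeal) hQ hcF)
  obtain ⟨Q, hQ, hle⟩ := (Ideal.IsPrime.inf_le' P.2).1 this
  exact h Q hQ hle

/-- Induction on finite sets of primes, removing minimal elements. -/
lemma Finset.induction_on_primes {motive : Finset (PrimeSpectrum A) → Prop}
    (empty : motive ∅)
    (insert : ∀ (P : PrimeSpectrum A) (F : Finset (PrimeSpectrum A))
      [DecidableEq (PrimeSpectrum A)], (∃ c ∉ P.asIdeal, ∀ Q ∈ F, c ∈ Q.asIdeal) →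
        motive F → motive (insert P F))
    (F : Finset (PrimeSpectrum A)) : motive F := by
  classical
  induction F using Finset.strongInduction with
  | H F ih =>
    rcases F.eq_empty_or_nonempty with rfl | hF
    · exact empty
    · obtain ⟨P, hP⟩ := F.exists_minimal hF
      rw [← Finset.insert_erase hP.1]
      refine insert P _ (exists_mem_forall_notMem _ _ fun Q hQ hle => ?_)
        (ih _ (Finset.erase_ssubset hP.1))
      exact Finset.ne_of_mem_erase hQ
        (le_antisymm hle (hP.2 (Finset.mem_of_mem_erase hQ) hle))

/-- Prime avoidance for cosets. -/
lemma exists_add_notMem (F : Finset (PrimeSpectrum A)) (I : Ideal A) (a : A)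
    (h : ∀ P ∈ F, a ∉ P.asIdeal ∨ ¬ I ≤ P.asIdeal) :
    ∃ b ∈ I, ∀ P ∈ F, a + b ∉ P.asIdeal := by
  induction F using Finset.induction_on_primes with
  | empty => exact ⟨0, I.zero_mem, by simp⟩
  | insert P F hc ih =>
    obtain ⟨b, hb, hF⟩ := ih fun Q hQ => h Q (Finset.mem_insert_of_mem hQ)
    by_cases hP : a + b ∈ P.asIdeal
    · have hI : ¬ I ≤ P.asIdeal := fun hI => by
        rcases h P (Finset.mem_insert_self _ _) with h | h
        · exact h ((Ideal.add_mem_iff_left _ (hI hb)).1 hP)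
        · exact h hI
      obtain ⟨d, hdI, hdP⟩ := SetLike.not_le_iff_exists.1 hI
      obtain ⟨c, hcP, hcF⟩ := hc
      refine ⟨b + c * d, I.add_mem hb (I.mul_mem_left _ hdI), fun Q hQ => ?_⟩
      rw [← add_assoc]
      rcases Finset.mem_insert.1 hQ with rfl | hQ
      · rw [Ideal.add_mem_iff_right _ hP]
        exact fun hmem => (Q.2.mem_or_mem hmem).elim hcP hdP
      · rw [Ideal.add_mem_iff_left _ (Q.asIdeal.mul_mem_right _ (hcF Q hQ))]
        exact hF Q hQ
    · refine ⟨b, hb, fun Q hQ => ?_⟩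
      rcases Finset.mem_insert.1 hQ with rfl | hQ
      · exact hP
      · exact hF Q hQ

end PrimeAvoidance

section EisenbudEvans

variable {A : Type*} [CommRing A] {M : Type*} [AddCommGroup M] [Module A M]

lemma finite_setOf_minimal_fiberRank_le [IsNoetherianRing A] [Module.Finite A M] {ι : Type*}
    [Finite ι] (m : ι → M) (w : ℕ) (I : Ideal A) :
    {P | Minimal (fun Q : PrimeSpectrum A =>
      I ≤ Q.asIdeal ∧ fiberRank Q.asIdeal m ≤ w) P}.Finite := by
  refine IsNoetherian.induction (P := fun I : Ideal A => {P | Minimal (fun Q : PrimeSpectrum A =>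
    I ≤ Q.asIdeal ∧ fiberRank Q.asIdeal m ≤ w) P}.Finite) (fun (I : Ideal A) ih => ?_) I
  · by_cases hI : I.IsPrime
    · obtain ⟨f, hf, hle⟩ := exists_fiberRank_le I m
      have hlt : I < I ⊔ Ideal.span {f} :=
        lt_of_le_of_ne le_sup_left fun h =>
          hf (h ▸ Ideal.mem_sup_right (Ideal.mem_span_singleton_self f))
      refine ((ih _ hlt).union (Set.finite_singleton ⟨I, hI⟩)).subset fun P hP => ?_
      by_cases hfP : f ∈ P.asIdeal
      · left
        refine ⟨⟨sup_le hP.1.1 (by simpa [Ideal.span_le] using hfP), hP.1.2⟩, fun Q hQ hQP => ?_⟩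
        exact hP.2 ⟨le_sup_left.trans hQ.1, hQ.2⟩ hQP
      · right
        have h1 : (⟨I, hI⟩ : PrimeSpectrum A) ≤ P := hP.1.1
        exact le_antisymm (hP.2 ⟨le_rfl, (hle P.asIdeal hP.1.1 hfP).trans hP.1.2⟩ h1) h1
    · rcases eq_or_ne I ⊤ with rfl | hne
      · refine Set.finite_empty.subset fun P hP => P.2.ne_top (top_le_iff.1 hP.1.1)
      · obtain ⟨a, ha, b, hb, hab⟩ : ∃ a, a ∉ I ∧ ∃ b, b ∉ I ∧ a * b ∈ I := by
          by_contra! h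
          exact hI ⟨hne, fun {a b} hab => by
            by_contra! h'
            exact h a h'.1 b h'.2 hab⟩
        have hlt : ∀ x ∉ I, I < I ⊔ Ideal.span {x} := fun x hx =>
          lt_of_le_of_ne le_sup_left fun h =>
            hx (h ▸ Ideal.mem_sup_right (Ideal.mem_span_singleton_self x))
        refine ((ih _ (hlt a ha)).union (ih _ (hlt b hb))).subset fun P hP => ?_
        have hx : ∀ x ∈ P.asIdeal, Minimal (fun Q : PrimeSpectrum A =>
            I ⊔ Ideal.span {x} ≤ Q.asIdeal ∧ fiberRank Q.asIdeal m ≤ w) P := fun x hx =>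
          ⟨⟨sup_le hP.1.1 (by simpa [Ideal.span_le] using hx), hP.1.2⟩, fun Q hQ hQP =>
            hP.2 ⟨le_sup_left.trans hQ.1, hQ.2⟩ hQP⟩
        rcases P.2.mem_or_mem (hP.1.1 hab) with h | h
        · exact Or.inl (hx a h)
        · exact Or.inr (hx b h)

lemma finrank_span_le_of_le {k V : Type*} [Field k] [AddCommGroup V] [Module k V] {s : Set V}
    (hs : s.Finite) {t : Set V} (h : t ⊆ Submodule.span k s) :
    Set.finrank k t ≤ Set.finrank k s := by
  have : Module.Finite k (Submodule.span k s) := .span_of_finite _ hs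
  exact Submodule.finrank_mono (Submodule.span_le.2 h)

lemma finrank_insert_le {k V : Type*} [Field k] [AddCommGroup V] [Module k V] {s : Set V}
    (hs : s.Finite) (x : V) : Set.finrank k (insert x s) ≤ Set.finrank k s + 1 := by
  have : Module.Finite k (Submodule.span k s) := .span_of_finite _ hs
  have h1 := Submodule.finrank_add_le_finrank_add_finrank (Submodule.span k {x})
    (Submodule.span k s)
  have h2 : Module.finrank k (Submodule.span k {x}) ≤ 1 :=
    (finrank_span_le_card {x}).trans (by simp)
  rw [Set.finrank, Submodule.span_insert, Set.finrank]
  exact h1.trans (by omega)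

/-- Either a family spans enough without `w`, or adding a nonzero multiple of `w` to one of its
members keeps the span large. -/
lemma exists_update_finrank_le {k V : Type*} [Field k] [AddCommGroup V] [Module k V] {u : ℕ}
    (v : Fin u → V) (w : V) :
    min u (Set.finrank k (insert w (Set.range v))) ≤ Set.finrank k (Set.range v) ∨
    ∃ j, ∀ t : k, t ≠ 0 → Set.finrank k (insert w (Set.range v)) ≤
      Set.finrank k (Set.range (Function.update v j (v j + t • w))) := by
  by_cases h : u ≤ Set.finrank k (Set.range v)
  · exact Or.inl ((min_le_left _ _).trans h)
  · right
    have hli : ¬ LinearIndependent k v := fun hli => h (by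
      rw [Set.finrank, finrank_span_eq_card hli, Fintype.card_fin])
    rw [linearIndependent_iff_notMem_span] at hli
    push Not at hli
    obtain ⟨j, hj⟩ := hli
    refine ⟨j, fun t ht => finrank_span_le_of_le (Set.finite_range _) ?_⟩
    set v' := Function.update v j (v j + t • w)
    have h1 : ∀ i ≠ j, v i ∈ Submodule.span k (Set.range v') := fun i hi =>
      Submodule.subset_span ⟨i, by simp [v', hi]⟩
    have h2 : v j ∈ Submodule.span k (Set.range v') := by
      refine Submodule.span_le.2 ?_ hj
      rintro _ ⟨i, hi, rfl⟩
      exact h1 i (by simpa using hi)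
    have h3 : w ∈ Submodule.span k (Set.range v') := by
      have : v j + t • w ∈ Submodule.span k (Set.range v') :=
        Submodule.subset_span ⟨j, by simp [v']⟩
      have := Submodule.smul_mem _ t⁻¹ ((Submodule.add_mem_iff_right _ h2).1 this)
      rwa [smul_smul, inv_mul_cancel₀ ht, one_smul] at this
    rintro x (rfl | ⟨i, rfl⟩)
    · exact h3
    · by_cases hi : i = j
      · exact hi ▸ h2
      · exact h1 i hi

/-- The image in the fibre at `P` of a sum. -/
lemma one_tmul_add_smul (P : Ideal A) [P.IsPrime] (x y : M) (a : A) :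
    (1 : P.ResidueField) ⊗ₜ[A] (x + a • y) =
      1 ⊗ₜ[A] x + algebraMap A P.ResidueField a • ((1 : P.ResidueField) ⊗ₜ[A] y) := by
  rw [TensorProduct.tmul_add, TensorProduct.tmul_smul, algebraMap_smul]

lemma exists_fiberRank_add_smul (F : Finset (PrimeSpectrum A)) {u : ℕ} (m : Fin u → M) (w : M) :
    ∃ a : Fin u → A, ∀ P ∈ F, min u (Set.finrank P.asIdeal.ResidueField
      (insert ((1 : P.asIdeal.ResidueField) ⊗ₜ[A] w)
        (Set.range fun i => (1 : P.asIdeal.ResidueField) ⊗ₜ[A] m i))) ≤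
      fiberRank P.asIdeal fun i => m i + a i • w := by
  induction F using Finset.induction_on_primes with
  | empty => exact ⟨0, by simp⟩
  | insert P F hc ih =>
    obtain ⟨a, ha⟩ := ih
    obtain ⟨c, hcP, hcF⟩ := hc
    have hle : Set.finrank P.asIdeal.ResidueField
      (insert ((1 : P.asIdeal.ResidueField) ⊗ₜ[A] w)
        (Set.range fun i => (1 : P.asIdeal.ResidueField) ⊗ₜ[A] m i)) ≤
        Set.finrank P.asIdeal.ResidueField
      (insert ((1 : P.asIdeal.ResidueField) ⊗ₜ[A] w)
        (Set.range fun i => (1 : P.asIdeal.ResidueField) ⊗ₜ[A] (m i + a i • w))) := by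
      refine finrank_span_le_of_le ((Set.finite_range _).insert _) ?_
      have hw := Submodule.subset_span (R := P.asIdeal.ResidueField)
        (Set.mem_insert ((1 : P.asIdeal.ResidueField) ⊗ₜ[A] w)
        (Set.range fun i => (1 : P.asIdeal.ResidueField) ⊗ₜ[A] (m i + a i • w)))
      rintro x (rfl | ⟨i, rfl⟩)
      · exact hw
      · rw [SetLike.mem_coe,
          ← Submodule.add_mem_iff_left _ (Submodule.smul_mem _ (algebraMap A _ (a i)) hw),
          ← one_tmul_add_smul]
        exact Submodule.subset_span (Or.inr ⟨i, rfl⟩)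
    rcases exists_update_finrank_le (k := P.asIdeal.ResidueField)
      (fun i => (1 : P.asIdeal.ResidueField) ⊗ₜ[A] (m i + a i • w)) (1 ⊗ₜ w) with h | ⟨j, hj⟩
    · refine ⟨a, fun Q hQ => ?_⟩
      rcases Finset.mem_insert.1 hQ with rfl | hQ
      · exact (min_le_min le_rfl hle).trans h
      · exact ha Q hQ
    · refine ⟨Function.update a j (a j + c), fun Q hQ => ?_⟩
      have hup : ∀ Q : PrimeSpectrum A, (fun i => (1 : Q.asIdeal.ResidueField) ⊗ₜ[A]
          (m i + Function.update a j (a j + c) i • w)) =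
          Function.update (fun i => (1 : Q.asIdeal.ResidueField) ⊗ₜ[A] (m i + a i • w)) j
          (1 ⊗ₜ[A] (m j + a j • w) +
            algebraMap A Q.asIdeal.ResidueField c • ((1 : Q.asIdeal.ResidueField) ⊗ₜ[A] w)) := by
        intro Q
        ext i
        by_cases hi : i = j
        · subst hi
          rw [Function.update_self, Function.update_self, ← one_tmul_add_smul, add_smul, add_assoc]
        · simp [Function.update_of_ne hi]
      rw [fiberRank, hup]
      rcases Finset.mem_insert.1 hQ with rfl | hQ
      · exact (min_le_right _ _).trans (hle.trans
          (hj _ (by rwa [Ne, Ideal.algebraMap_residueField_eq_zero])))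
      · have h0 : algebraMap A Q.asIdeal.ResidueField c = 0 :=
          Ideal.algebraMap_residueField_eq_zero.2 (hcF Q hQ)
        rw [h0, zero_smul, add_zero, Function.update_eq_self]
        exact ha Q hQ

lemma exists_fiberRank_pred [IsNoetherianRing A] [Module.Finite A M] (I : Ideal A)
    (δ : PrimeSpectrum A → ℕ) (hδ : StrictAnti δ) {u : ℕ} (m : Fin (u + 1) → M)
    (hm : ∀ P : PrimeSpectrum A, I ≤ P.asIdeal → min (u + 1) (δ P + 1) ≤ fiberRank P.asIdeal m) :
    ∃ m' : Fin u → M, ∀ P : PrimeSpectrum A, I ≤ P.asIdeal →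
      min u (δ P + 1) ≤ fiberRank P.asIdeal m' := by
  have hfin : (⋃ w ∈ Finset.range (u + 1), {P | Minimal (fun Q : PrimeSpectrum A =>
      I ≤ Q.asIdeal ∧ fiberRank Q.asIdeal m ≤ w) P}).Finite :=
    (Finset.finite_toSet _).biUnion fun w _ => finite_setOf_minimal_fiberRank_le m w I
  obtain ⟨a, ha⟩ := exists_fiberRank_add_smul hfin.toFinset (fun i : Fin u => m i.castSucc)
    (m (Fin.last u))
  refine ⟨fun i => m i.castSucc + a i • m (Fin.last u), fun P hP => ?_⟩
  have hins : ∀ P : PrimeSpectrum A, insert ((1 : P.asIdeal.ResidueField) ⊗ₜ[A] m (Fin.last u))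
        (Set.range fun i : Fin u => (1 : P.asIdeal.ResidueField) ⊗ₜ[A] m i.castSucc) =
        Set.range fun i => (1 : P.asIdeal.ResidueField) ⊗ₜ[A] m i := by
    intro P
    ext x
    simp only [Set.mem_insert_iff, Set.mem_range]
    constructor
    · rintro (rfl | ⟨i, rfl⟩)
      exacts [⟨_, rfl⟩, ⟨_, rfl⟩]
    · rintro ⟨i, rfl⟩
      induction i using Fin.lastCases with
      | last => exact Or.inl rfl
      | cast i => exact Or.inr ⟨i, rfl⟩
  by_cases hmem : P ∈ hfin.toFinset
  · refine le_trans ?_ (ha P hmem)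
    rw [hins]
    have := hm P hP
    rw [fiberRank] at this
    omega
  · have h1 : fiberRank P.asIdeal m ≤
        fiberRank P.asIdeal (fun i : Fin u => m i.castSucc + a i • m (Fin.last u)) + 1 := by
      refine le_trans ?_ (finrank_insert_le (Set.finite_range _)
        ((1 : P.asIdeal.ResidueField) ⊗ₜ[A] m (Fin.last u)))
      rw [fiberRank, ← hins]
      refine finrank_span_le_of_le ((Set.finite_range _).insert _) ?_
      have hw := Submodule.subset_span (R := P.asIdeal.ResidueField) (Set.mem_insert
        ((1 : P.asIdeal.ResidueField) ⊗ₜ[A] m (Fin.last u))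
        (Set.range fun i : Fin u => (1 : P.asIdeal.ResidueField) ⊗ₜ[A]
          (m i.castSucc + a i • m (Fin.last u))))
      rintro x (rfl | ⟨i, rfl⟩)
      · exact hw
      · rw [SetLike.mem_coe, ← Submodule.add_mem_iff_left _
          (Submodule.smul_mem _ (algebraMap A _ (a i)) hw), ← one_tmul_add_smul]
        exact Submodule.subset_span (Or.inr ⟨i, rfl⟩)
    have h2 := hm P hP
    by_contra! hcon
    have hw : fiberRank P.asIdeal m = δ P + 1 ∧ δ P + 1 ≤ u := by omega
    refine hmem (hfin.mem_toFinset.2 (Set.mem_biUnion (x := δ P + 1) (by simp; omega) ?_))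
    refine ⟨⟨hP, hw.1.le⟩, fun Q hQ hQP => ?_⟩
    by_contra hPQ
    have hlt := hδ (lt_of_le_not_ge hQP hPQ)
    have := hm Q hQ.1
    omega

/-- The Eisenbud–Evans theorem on basic elements, on a closed subset of the spectrum. -/
theorem exists_one_tmul_ne_zero [IsNoetherianRing A] [Module.Finite A M] (I : Ideal A)
    (δ : PrimeSpectrum A → ℕ) (hδ : StrictAnti δ)
    (hM : ∀ P : PrimeSpectrum A, I ≤ P.asIdeal →
      δ P + 1 ≤ Module.finrank P.asIdeal.ResidueField (P.asIdeal.ResidueField ⊗[A] M)) :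
    ∃ x : M, ∀ P : PrimeSpectrum A, I ≤ P.asIdeal → (1 : P.asIdeal.ResidueField) ⊗ₜ[A] x ≠ 0 := by
  obtain ⟨n, m, hm⟩ := Module.Finite.exists_fin (R := A) (M := M)
  have key : ∀ n (m : Fin n → M), (∀ P : PrimeSpectrum A, I ≤ P.asIdeal →
      min n (δ P + 1) ≤ fiberRank P.asIdeal m) → ∀ k, 1 ≤ k → k ≤ n → ∃ m' : Fin k → M,
      ∀ P : PrimeSpectrum A, I ≤ P.asIdeal → min k (δ P + 1) ≤ fiberRank P.asIdeal m' := by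
    intro n m hm k hk hkn
    induction hkn using Nat.decreasingInduction with
    | self => exact ⟨m, hm⟩
    | of_succ k _ ih =>
      obtain ⟨m', hm'⟩ := ih (by omega)
      exact exists_fiberRank_pred I δ hδ m' hm'
  have hfull : ∀ P : PrimeSpectrum A, fiberRank P.asIdeal m =
      Module.finrank P.asIdeal.ResidueField (P.asIdeal.ResidueField ⊗[A] M) := by
    intro P
    have := congrArg (Submodule.baseChange P.asIdeal.ResidueField) hm
    rw [Submodule.baseChange_span, Submodule.baseChange_top, ← Set.range_comp] at this
    rw [fiberRank, Set.finrank]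
    exact (congrArg (fun N : Submodule _ _ => Module.finrank P.asIdeal.ResidueField N) this).trans
      (finrank_top _ _)
  rcases Nat.eq_zero_or_pos n with rfl | hn
  · refine ⟨0, fun P hP => ?_⟩
    have h1 := hM P hP
    rw [← hfull, fiberRank] at h1
    rw [Set.range_eq_empty, Set.finrank_empty] at h1
    omega
  · obtain ⟨m', hm'⟩ := key n m
      (fun P hP => by rw [hfull]; exact (min_le_right _ _).trans (hM P hP)) 1 le_rfl hn
    refine ⟨m' 0, fun P hP h0 => ?_⟩
    have h1 := hm' P hP
    have h2 : (Set.range fun i => (1 : P.asIdeal.ResidueField) ⊗ₜ[A] m' i) ⊆ {0} := by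
      rintro _ ⟨i, rfl⟩
      rw [Subsingleton.elim i 0]; exact h0
    have h3 : fiberRank P.asIdeal m' = 0 := by
      rw [fiberRank, Set.finrank, Submodule.span_eq_bot.2 fun x hx => h2 hx, finrank_bot]
    omega

end EisenbudEvans

section GLEquiv

variable {ι : Type*} [Fintype ι] [DecidableEq ι] {B B' : Type*} [CommRing B] [CommRing B']

/-- Two vectors are `GLEquiv` if an invertible matrix carries the first to the second. -/
def GLEquiv (v w : ι → B) : Prop :=
  ∃ G H : Matrix ι ι B, H * G = 1 ∧ G.mulVec v = w

lemma GLEquiv.refl (v : ι → B) : GLEquiv v v := ⟨1, 1, by simp, by simp⟩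

lemma GLEquiv.symm {v w : ι → B} : GLEquiv v w → GLEquiv w v := by
  rintro ⟨G, H, h, rfl⟩
  exact ⟨H, G, mul_eq_one_comm.1 h, by rw [Matrix.mulVec_mulVec, h, Matrix.one_mulVec]⟩

lemma GLEquiv.trans {u v w : ι → B} : GLEquiv u v → GLEquiv v w → GLEquiv u w := by
  rintro ⟨G, H, h, rfl⟩ ⟨G', H', h', rfl⟩
  refine ⟨G' * G, H * H', ?_, by rw [Matrix.mulVec_mulVec]⟩
  rw [Matrix.mul_assoc, ← Matrix.mul_assoc H', h', Matrix.one_mul, h]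

lemma RingHom.map_mulVec_eq (φ : B →+* B') (G : Matrix ι ι B) (v : ι → B) :
    (φ.mapMatrix G).mulVec (fun i => φ (v i)) = fun i => φ (G.mulVec v i) := by
  ext i
  simp [Matrix.mulVec, dotProduct]

lemma GLEquiv.map (φ : B →+* B') {v w : ι → B} :
    GLEquiv v w → GLEquiv (fun i => φ (v i)) (fun i => φ (w i)) := by
  rintro ⟨G, H, h, rfl⟩
  exact ⟨φ.mapMatrix G, φ.mapMatrix H, by rw [← map_mul, h, map_one], φ.map_mulVec_eq G v⟩

lemma GLEquiv.of_linearEquiv (e : (ι → B) ≃ₗ[B] (ι → B)) (v : ι → B) : GLEquiv v (e v) := by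
  refine ⟨LinearMap.toMatrix' e.toLinearMap, LinearMap.toMatrix' e.symm.toLinearMap, ?_, ?_⟩
  · rw [← LinearMap.toMatrix'_comp]
    simp
  · rw [LinearMap.toMatrix'_mulVec]
    rfl

/-- A vector two of whose entries generate the unit ideal is equivalent to a basis vector. -/
lemma GLEquiv.single_of_isCoprime {i j : ι} (hij : i ≠ j) {v : ι → B} (h : IsCoprime (v i) (v j)) :
    GLEquiv v (Pi.single i 1) := by
  obtain ⟨a, b, hab⟩ := h
  let e : (ι → B) ≃ₗ[B] (ι → B) :=
    { toFun := fun w l => if l = i then a * w i + b * w j else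
        if l = j then v i * w j - v j * w i else w l
      invFun := fun w l => if l = i then v i * w i - b * w j else
        if l = j then v j * w i + a * w j else w l
      map_add' := fun x y => by
        ext l; simp only [Pi.add_apply]; split_ifs <;> ring
      map_smul' := fun x y => by
        ext l; simp only [Pi.smul_apply, smul_eq_mul, RingHom.id_apply]; split_ifs <;> ring
      left_inv := fun w => by
        ext l
        by_cases hi : l = i
        · subst hi; simp only [if_true, hij.symm, if_false]; linear_combination w l * hab
        · by_cases hj : l = j
          · subst hj; simp only [if_true, hi, if_false]; linear_combination w l * hab
          · simp [hi, hj]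
      right_inv := fun w => by
        ext l
        by_cases hi : l = i
        · subst hi; simp only [if_true, hij.symm, if_false]; linear_combination w l * hab
        · by_cases hj : l = j
          · subst hj; simp only [if_true, hi, if_false]; linear_combination w l * hab
          · simp [hi, hj] }
  have hei : e v i = 1 := by
    change (if i = i then a * v i + b * v j else _) = 1
    rw [if_pos rfl, hab]
  refine (of_linearEquiv e v).trans ?_
  have hu : LinearMap.proj (R := B) (φ := fun _ : ι => B) i (Pi.single i 1 - e v) = 0 := by
    simp [hei]
  convert of_linearEquiv (LinearEquiv.transvection hu) (e v) using 1
  change _ = e v + (e v i) • (Pi.single i 1 - e v)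
  rw [hei, one_smul, add_sub_cancel]

lemma GLEquiv.update_add {j : ι} (v : ι → B) (c : ι → B) :
    GLEquiv v (Function.update v j (v j + ∑ i ∈ Finset.univ.erase j, c i * v i)) := by
  have hu : (∑ i ∈ Finset.univ.erase j, c i • LinearMap.proj (R := B) (φ := fun _ : ι => B) i)
      (Pi.single j 1) = 0 := by
    rw [LinearMap.sum_apply]
    refine Finset.sum_eq_zero fun i hi => ?_
    simp [Finset.ne_of_mem_erase hi]
  convert of_linearEquiv (LinearEquiv.transvection hu) v using 1
  change _ = v + ((∑ i ∈ Finset.univ.erase j, c i • LinearMap.proj i) v) • Pi.single j 1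
  rw [LinearMap.sum_apply]
  ext l
  by_cases hl : l = j
  · subst hl; simp
  · simp [hl]

end GLEquiv

section Horrocks

variable {ι : Type*} [Fintype ι] [DecidableEq ι]

lemma isCoprime_of_forall_isPrime {B : Type*} [CommRing B] {x y : B}
    (h : ∀ P : Ideal B, P.IsPrime → x ∈ P → y ∉ P) : IsCoprime x y := by
  rw [← Ideal.isCoprime_span_singleton_iff, Ideal.isCoprime_iff_sup_eq]
  by_contra hne
  obtain ⟨P, hP, hle⟩ := Ideal.exists_le_maximal _ hne
  rw [sup_le_iff, Ideal.span_singleton_le_iff_mem, Ideal.span_singleton_le_iff_mem] at hle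
  exact h P hP.isPrime hle.1 hle.2

/-- Over a field, a unimodular row can be modified in one entry so as to make this entry coprime
to a given nonzero entry. -/
lemma exists_isCoprime_add_sum {k : Type*} [Field k] {f : ι → k[X]}
    (hf : Ideal.span (Set.range f) = ⊤) {i j : ι} (hi : f i ≠ 0) :
    ∃ c : ι → k[X], c i = 0 ∧
      IsCoprime (f i) (f j + ∑ l ∈ Finset.univ.erase j, c l * f l) := by
  have hfin : {P : PrimeSpectrum k[X] | f i ∈ P.asIdeal}.Finite := by
    refine ((Ideal.finite_minimalPrimes_of_isNoetherianRing k[X]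
      (Ideal.span {f i})).preimage (f := PrimeSpectrum.asIdeal)
      (fun P _ Q _ h => PrimeSpectrum.ext h)).subset fun P hP => ?_
    obtain ⟨Q, hQ, hQP⟩ := Ideal.exists_minimalPrimes_le
      ((Ideal.span_singleton_le_iff_mem P.asIdeal).2 hP)
    have hQp := hQ.1.1
    have hQi : f i ∈ Q := hQ.1.2 (Ideal.mem_span_singleton_self _)
    have hQ0 : Q ≠ ⊥ := fun h => hi (by simpa [h] using hQi)
    have := hQp.isMaximal hQ0
    rw [Set.mem_preimage, ← this.eq_of_le P.2.ne_top hQP]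
    exact hQ
  obtain ⟨b, hb, hF⟩ := exists_add_notMem hfin.toFinset
    (Ideal.span (f '' {l | l ≠ i ∧ l ≠ j})) (f j) (fun P hP => by
      by_contra! h
      refine P.2.ne_top (top_le_iff.1 (hf ▸ Ideal.span_le.2 ?_))
      rintro _ ⟨l, rfl⟩
      by_cases hli : l = i
      · exact hli ▸ (by simpa using hP)
      · by_cases hlj : l = j
        · exact hlj ▸ h.1
        · exact h.2 (Ideal.subset_span ⟨l, ⟨hli, hlj⟩, rfl⟩))
  have hb' : ∀ b ∈ Ideal.span (f '' {l | l ≠ i ∧ l ≠ j}),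
      ∃ c : ι → k[X], c i = 0 ∧ ∑ l ∈ Finset.univ.erase j, c l * f l = b := by
    intro b hb
    induction hb using Submodule.span_induction with
    | mem x hx =>
      obtain ⟨l, ⟨hli, hlj⟩, rfl⟩ := hx
      exact ⟨Pi.single l 1, by simp [Ne.symm hli], by simp [Pi.single_apply, ite_mul, hlj]⟩
    | zero => exact ⟨0, by simp, by simp⟩
    | add x y _ _ hx hy =>
      obtain ⟨c, hc, rfl⟩ := hx
      obtain ⟨c', hc', rfl⟩ := hy
      exact ⟨c + c', by simp [hc, hc'],
        by simp only [Pi.add_apply, add_mul, Finset.sum_add_distrib]⟩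
    | smul a x _ hx =>
      obtain ⟨c, hc, rfl⟩ := hx
      exact ⟨a • c, by simp [hc],
        by simp only [Pi.smul_apply, smul_eq_mul, Finset.mul_sum, mul_assoc]⟩
  obtain ⟨c, hc, rfl⟩ := hb' b hb
  exact ⟨c, hc, isCoprime_of_forall_isPrime fun P hP hiP => hF ⟨P, hP⟩ (by simpa using hiP)⟩

/-- Horrocks' theorem for rows over a polynomial ring over a local ring. -/
lemma GLEquiv.horrocks_of_isLocalRing {O : Type*} [CommRing O] [IsLocalRing O] {f : ι → O[X]}
    (hf : Ideal.span (Set.range f) = ⊤) {i j : ι} (hij : i ≠ j)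
    (hi : IsUnit (f i).leadingCoeff) :
    GLEquiv (fun l => C ((f l).eval 0)) f := by
  have key : GLEquiv f (Pi.single i 1) := by
    let π := mapRingHom (IsLocalRing.residue O)
    have hπ : Function.Surjective π := map_surjective _ IsLocalRing.residue_surjective
    have hi0 : π (f i) ≠ 0 := fun h => by
      have := congrArg (fun p => p.coeff (f i).natDegree) h
      simp only [π, coe_mapRingHom, coeff_map, coeff_natDegree, coeff_zero] at this
      exact (hi.map (IsLocalRing.residue O)).ne_zero this
    obtain ⟨c, -, hc⟩ := exists_isCoprime_add_sum (f := fun l => π (f l)) (j := j) (by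
      have := congrArg (Ideal.map π) hf
      rwa [Ideal.map_span, Ideal.map_top, ← Set.range_comp] at this) hi0
    choose c' hc' using fun l => hπ (c l)
    obtain ⟨u, v, huv⟩ := hc
    obtain ⟨u, rfl⟩ := hπ u
    obtain ⟨v, rfl⟩ := hπ v
    have hker : u * f i + v * (f j + ∑ l ∈ Finset.univ.erase j, c' l * f l) - 1 ∈
        RingHom.ker π := by
      rw [RingHom.mem_ker, map_sub, sub_eq_zero, map_one, ← huv]
      simp only [map_add, map_mul, map_sum, hc']
    rw [ker_mapRingHom, IsLocalRing.ker_residue] at hker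
    refine (update_add (j := j) f c').trans (single_of_isCoprime hij ?_)
    rw [Function.update_self, Function.update_of_ne hij]
    refine isCoprime_of_forall_isPrime fun P hP hiP hjP => ?_
    obtain ⟨N, hN, hPN⟩ := Ideal.exists_le_maximal P hP.ne_top
    have hmon : (C (↑hi.unit⁻¹ : O) * f i).Monic := by
      rw [Monic, leadingCoeff_C_mul_of_isUnit (Units.isUnit _)]
      exact hi.val_inv_mul
    have hint := hmon.quotient_isIntegral (I := N) (N.mul_mem_left _ (hPN hiP))
    let := Ideal.Quotient.field N
    have hmax := Ideal.isMaximal_comap_of_isIntegral_of_isMaximal' _ hint (⊥ : Ideal (O[X] ⧸ N))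
    have hle : (IsLocalRing.maximalIdeal O).map C ≤ N := by
      rw [← IsLocalRing.eq_maximalIdeal hmax, Ideal.map_le_iff_le_comap]
      intro x hx
      rw [Ideal.mem_comap, ← Ideal.Quotient.eq_zero_iff_mem]
      exact hx
    refine hN.ne_top ((Ideal.eq_top_iff_one _).2 ?_)
    have := N.sub_mem (N.add_mem (N.mul_mem_left u (hPN hiP)) (N.mul_mem_left v (hPN hjP)))
      (hle hker)
    rwa [sub_sub_cancel] at this
  refine GLEquiv.trans ?_ key.symm
  have h := (key.map (evalRingHom 0)).map (C : O →+* O[X])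
  convert h using 1
  · rfl
  · ext l : 1
    by_cases hl : l = i
    · subst hl; simp
    · simp [hl]

/-- Evaluating at multiples of a denominator of the higher coefficients. -/
lemma eval_mul_sub_coeff_zero_mem {E : Type*} [CommRing E] (D : Subring E) (N : AddSubgroup E)
    (hN : ∀ d ∈ D, ∀ n ∈ N, d * n ∈ N) {p : E[X]} {t z : E} (ht : t ∈ D) (hz : z ∈ D)
    (hp : ∀ j, t * p.coeff j ∈ N) : p.eval (t * z) - p.coeff 0 ∈ N := by
  rw [eval_eq_sum_range, Finset.sum_range_succ', pow_zero, mul_one, add_sub_cancel_right]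
  refine N.sum_mem fun j _ => ?_
  have : p.coeff (j + 1) * (t * z) ^ (j + 1) = (z * (t * z) ^ j) * (t * p.coeff (j + 1)) := by ring
  rw [this]
  exact hN _ (D.mul_mem hz (D.pow_mem (D.mul_mem ht hz) j)) _ (hp _)

/-- A common denominator for the coefficients of finitely many polynomials. -/
lemma exists_forall_mul_coeff_mem {E : Type*} [CommRing E] (T : Submonoid E) (N : AddSubgroup E)
    (hTN : ∀ t ∈ T, ∀ n ∈ N, t * n ∈ N) (hT : ∀ e, ∃ t ∈ T, t * e ∈ N) {κ : Type*} [Finite κ]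
    (p : κ → E[X]) : ∃ t ∈ T, ∀ i j, t * (p i).coeff j ∈ N := by
  classical
  have := Fintype.ofFinite κ
  choose t ht htN using hT
  let F : Finset E := Finset.univ.biUnion fun i => (p i).coeffs
  refine ⟨∏ e ∈ F, t e, T.prod_mem fun e _ => ht e, fun i j => ?_⟩
  by_cases h0 : (p i).coeff j = 0
  · rw [h0, mul_zero]; exact N.zero_mem
  · have hmem : (p i).coeff j ∈ F :=
      Finset.mem_biUnion.2 ⟨i, Finset.mem_univ _, coeff_mem_coeffs h0⟩
    rw [← Finset.prod_erase_mul _ _ hmem, mul_assoc]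
    exact hTN _ (T.prod_mem fun e _ => ht e) _ (htN _)

lemma Localization.exists_C_mul_mem_range {C' L : Type*} [CommRing C'] [CommRing L] [Algebra C' L]
    (S : Submonoid C') [IsLocalization S L] (g : L[X]) :
    ∃ c ∈ S, Polynomial.C (algebraMap C' L c) * g ∈ (mapRingHom (algebraMap C' L)).range := by
  induction g using Polynomial.induction_on' with
  | add p q hp hq =>
    obtain ⟨c, hc, hp⟩ := hp
    obtain ⟨d, hd, hq⟩ := hq
    refine ⟨c * d, S.mul_mem hc hd, ?_⟩
    have hC : ∀ c : C', Polynomial.C (algebraMap C' L c) ∈ (mapRingHom (algebraMap C' L)).range :=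
      fun c => ⟨Polynomial.C c, by simp⟩
    have := Subring.add_mem _ (Subring.mul_mem _ (hC d) hp) (Subring.mul_mem _ (hC c) hq)
    convert this using 1
    simp only [map_mul]
    ring
  | monomial n a =>
    obtain ⟨⟨b, c⟩, h⟩ := IsLocalization.surj S a
    refine ⟨c, c.2, monomial n b, ?_⟩
    rw [coe_mapRingHom, map_monomial, ← h, C_mul_monomial, mul_comm]

/-- Vaserstein's denominator argument. -/
lemma GLEquiv.exists_add_mul {C' L : Type*} [CommRing C'] [CommRing L] [Algebra C' L]
    (S : Submonoid C') [IsLocalization S L] (hinj : Function.Injective (algebraMap C' L))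
    {f : ι → C'[X]} {v : ι → L}
    (h : GLEquiv (fun l => C (v l)) fun l => (f l).map (algebraMap C' L)) :
    ∃ c ∈ S, ∀ x y : C'[X],
      GLEquiv (fun l => aeval (x + C c * y) (f l)) (fun l => aeval x (f l)) := by
  obtain ⟨G, H, hHG, hG⟩ := h
  have hGH := mul_eq_one_comm.1 hHG
  let φ := algebraMap C' L
  let ψ : C'[X] →+* L[X] := mapRingHom φ
  have hψ : Function.Injective ψ := map_injective _ hinj
  let θ : L[X] →+* L[X][X] := (aeval (C X + X : L[X][X])).toRingHom
  let P : Matrix ι ι L[X][X] := (C : L[X] →+* _).mapMatrix G * θ.mapMatrix H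
  let Q : Matrix ι ι L[X][X] := θ.mapMatrix G * (C : L[X] →+* _).mapMatrix H
  obtain ⟨_, ⟨c, hc, rfl⟩, hcPQ⟩ := exists_forall_mul_coeff_mem (S.map (C.comp φ : C' →+* L[X]))
    ψ.range.toAddSubgroup
    (by
      rintro _ ⟨t, -, rfl⟩ n hn
      exact ψ.range.mul_mem ⟨C t, by simp [ψ, φ]⟩ hn)
    (fun e => by
      obtain ⟨c, hc, h⟩ := Localization.exists_C_mul_mem_range S e
      exact ⟨_, ⟨c, hc, rfl⟩, h⟩)
    (Sum.elim (fun i : ι × ι => P i.1 i.2) fun i : ι × ι => Q i.1 i.2)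
  refine ⟨c, hc, fun x y => ?_⟩
  let ev : L[X] → L[X] →+* L[X] := fun z => (aeval z : L[X] →ₐ[L] L[X]).toRingHom
  have hev : ∀ (z : C'[X]) (g : C'[X]), ψ (aeval z g) = ev (ψ z) (g.map φ) := by
    intro z g
    have : ψ.comp (aeval z : C'[X] →ₐ[C'] C'[X]).toRingHom = (ev (ψ z)).comp ψ := by
      ext <;> simp [ψ, ev, φ]
    exact RingHom.congr_fun this g
  let σ : L[X][X] →+* L[X] := (evalRingHom (ψ (C c) * ψ y)).comp (mapRingHom (ev (ψ x)))
  have hσC : σ.comp C = ev (ψ x) := by ext <;> simp [σ, ev]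
  have hσθ : σ.comp θ = ev (ψ (x + C c * y)) := by
    ext <;> simp [σ, ev, θ]
  have hcC : (constantCoeff : L[X][X] →+* L[X]).comp C = RingHom.id _ := by ext <;> simp
  have hcθ : (constantCoeff : L[X][X] →+* L[X]).comp θ = RingHom.id _ := by
    ext <;> simp [θ]
  have hmem : ∀ p : L[X][X], (∀ j, C (φ c) * p.coeff j ∈ ψ.range) →
      ev (ψ x) (constantCoeff p) ∈ ψ.range → σ p ∈ ψ.range := by
    intro p hp h0
    have := eval_mul_sub_coeff_zero_mem ψ.range ψ.range.toAddSubgroup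
      (fun d hd n hn => ψ.range.mul_mem hd hn) (p := p.map (ev (ψ x))) (t := ψ (C c))
      (z := ψ y) ⟨_, rfl⟩ ⟨_, rfl⟩ (fun j => by
        obtain ⟨g, hg⟩ := hp j
        refine ⟨aeval x g, ?_⟩
        rw [hev, coeff_map]
        change ev (ψ x) (ψ g) = _
        rw [hg, map_mul]
        simp [ψ, ev, φ])
    rw [coeff_map] at this
    have := ψ.range.add_mem this h0
    rwa [constantCoeff_apply, sub_add_cancel] at this
  have hone : ∀ i j, ev (ψ x) ((1 : Matrix ι ι L[X]) i j) ∈ ψ.range := by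
    intro i j
    rw [Matrix.one_apply]
    split_ifs
    · rw [map_one]; exact ψ.range.one_mem
    · rw [map_zero]; exact ψ.range.zero_mem
  have hP0 : (constantCoeff : L[X][X] →+* L[X]).mapMatrix P = 1 := by
    rw [map_mul]
    change (constantCoeff.comp C).mapMatrix G * (constantCoeff.comp θ).mapMatrix H = 1
    rw [hcC, hcθ]
    simpa using hGH
  have hQ0 : (constantCoeff : L[X][X] →+* L[X]).mapMatrix Q = 1 := by
    rw [map_mul]
    change (constantCoeff.comp θ).mapMatrix G * (constantCoeff.comp C).mapMatrix H = 1
    rw [hcC, hcθ]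
    simpa using hGH
  have hPr : ∀ i j, σ (P i j) ∈ ψ.range := fun i j =>
    hmem _ (hcPQ (Sum.inl (i, j))) (by
      have := congrFun (congrFun hP0 i) j
      rw [RingHom.mapMatrix_apply, Matrix.map_apply] at this
      rw [this]; exact hone i j)
  have hQr : ∀ i j, σ (Q i j) ∈ ψ.range := fun i j =>
    hmem _ (hcPQ (Sum.inr (i, j))) (by
      have := congrFun (congrFun hQ0 i) j
      rw [RingHom.mapMatrix_apply, Matrix.map_apply] at this
      rw [this]; exact hone i j)
  choose G' hG' using hPr
  choose H' hH' using hQr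
  have hG'' : ψ.mapMatrix (Matrix.of G') = σ.mapMatrix P := by
    ext1 i j; exact hG' i j
  have hH'' : ψ.mapMatrix (Matrix.of H') = σ.mapMatrix Q := by
    ext1 i j; exact hH' i j
  refine ⟨Matrix.of G', Matrix.of H', ?_, ?_⟩
  · apply Matrix.map_injective hψ
    change ψ.mapMatrix _ = ψ.mapMatrix 1
    rw [map_mul, map_one, hG'', hH'', ← map_mul]
    have : Q * P = 1 := by
      simp only [P, Q]
      rw [Matrix.mul_assoc, ← Matrix.mul_assoc (RingHom.mapMatrix C H), ← map_mul, hHG, map_one,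
        Matrix.one_mul, ← map_mul, hGH, map_one]
    rw [this, map_one]
  · ext1 l
    apply hψ
    have h1 := congrFun (ψ.map_mulVec_eq (Matrix.of G') fun l => aeval (x + C c * y) (f l)) l
    rw [← h1, hG'', hev]
    simp only [hev, P, map_mul]
    change (((σ.comp C).mapMatrix G * (σ.comp θ).mapMatrix H).mulVec _) l = _
    rw [hσC, hσθ, ← Matrix.mulVec_mulVec, RingHom.map_mulVec_eq]
    have h2 : H.mulVec (fun l => (f l).map φ) = fun l => C (v l) := by
      rw [← hG, Matrix.mulVec_mulVec, hHG, Matrix.one_mulVec]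
    have h3 : (fun i => ev (ψ (x + C c * y)) (C (v i))) = fun i => ev (ψ x) (C (v i)) := by
      ext1 i; simp [ev]
    rw [h2, h3, RingHom.map_mulVec_eq, hG]

/-- Horrocks' theorem for rows over a polynomial ring over a domain. -/
theorem GLEquiv.horrocks {C' : Type*} [CommRing C'] [IsDomain C'] {f : ι → C'[X]}
    (hf : Ideal.span (Set.range f) = ⊤) {i j : ι} (hij : i ≠ j)
    (hi : IsUnit (f i).leadingCoeff) :
    GLEquiv (fun l => C ((f l).eval 0)) f := by
  let J : Ideal C' :=
    { carrier := {c | ∀ x y : C'[X],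
        GLEquiv (fun l => aeval (x + C c * y) (f l)) (fun l => aeval x (f l))}
      zero_mem' := fun x y => by
        simp only [map_zero, zero_mul, add_zero]
        exact GLEquiv.refl _
      add_mem' := fun {a b} ha hb x y => by
        have h := (hb (x + C a * y) y).trans (ha x y)
        rwa [add_assoc, ← add_mul, ← map_add] at h
      smul_mem' := fun a c hc x y => by
        have h := hc x (C a * y)
        rwa [← mul_assoc, ← map_mul, mul_comm c] at h }
  have hJ : J = ⊤ := by
    by_contra hne
    obtain ⟨m, hm, hle⟩ := Ideal.exists_le_maximal _ hne
    let φ := algebraMap C' (Localization.AtPrime m)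
    have hinj : Function.Injective φ :=
      IsLocalization.injective _ (Ideal.primeCompl_le_nonZeroDivisors m)
    have hloc : GLEquiv (fun l => C (((f l).map φ).eval 0)) (fun l => (f l).map φ) := by
      refine horrocks_of_isLocalRing ?_ hij ?_
      · have := congrArg (Ideal.map (mapRingHom φ)) hf
        rwa [Ideal.map_span, Ideal.map_top, ← Set.range_comp] at this
      · rw [leadingCoeff_map_of_injective hinj]
        exact hi.map φ
    obtain ⟨c, hc, h⟩ := exists_add_mul m.primeCompl hinj hloc
    exact hc (hle h)
  have h := ((Ideal.eq_top_iff_one J).1 hJ 0 X).symm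
  convert h using 1
  · ext1 l
    simp [aeval_def, eval₂_at_zero, coeff_zero_eq_eval_zero]
  · ext1 l
    simp

end Horrocks

section Patching

/-- The elements carried into a subring by an element of a multiplicative subset of it. -/
def Subring.fractions {E : Type*} [CommRing E] (A : Subring E) (T : Submonoid E)
    (hT : T ≤ A.toSubmonoid) : Subring E where
  carrier := {g | ∃ t ∈ T, t * g ∈ A}
  zero_mem' := ⟨1, T.one_mem, by simp [A.zero_mem]⟩
  one_mem' := ⟨1, T.one_mem, by simp [A.one_mem]⟩
  add_mem' := by
    rintro x y ⟨t, ht, hx⟩ ⟨u, hu, hy⟩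
    refine ⟨t * u, T.mul_mem ht hu, ?_⟩
    convert A.add_mem (A.mul_mem (hT hu) hx) (A.mul_mem (hT ht) hy) using 1
    ring
  mul_mem' := by
    rintro x y ⟨t, ht, hx⟩ ⟨u, hu, hy⟩
    refine ⟨t * u, T.mul_mem ht hu, ?_⟩
    convert A.mul_mem hx hy using 1
    ring
  neg_mem' := by
    rintro x ⟨t, ht, hx⟩
    exact ⟨t, ht, by rw [mul_neg]; exact A.neg_mem hx⟩

lemma Subring.le_fractions {E : Type*} [CommRing E] (A : Subring E) (T : Submonoid E)
    (hT : T ≤ A.toSubmonoid) : A ≤ A.fractions T hT :=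
  fun g hg => ⟨1, T.one_mem, by rwa [one_mul]⟩

variable {ι : Type*} [Fintype ι] [DecidableEq ι]

lemma exists_mem_of_glEquiv {R L : Type*} [CommRing R] [CommRing L] (φ : R →+* L)
    (hφ : Function.Injective φ) (A : Subring R[X]) (hC : ∀ c, C c ∈ A) {s : R}
    (hA : ∀ f : R[X], ∃ n : ℕ, C (s ^ n) * f ∈ A) (T : Submonoid R) (hT : ∀ t ∈ T, IsCoprime s t)
    (hL : ∀ g : L[X], ∃ n : ℕ, ∃ t ∈ T, C (φ (s ^ n * t)) * g ∈ (mapRingHom φ).range)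
    {f : ι → R[X]} (hf : ∀ i, f i ∈ A) {n₀ : ℕ}
    (hn₀ : s ^ n₀ ∈ Ideal.span (Set.range fun i => (f i).eval 0))
    (h : GLEquiv (fun l => C (φ ((f l).eval 0))) fun l => (f l).map φ) (k : ℕ) :
    ∃ a : ι → R[X], (∀ i, ∃ b ∈ A, a i = f i + C (s ^ k) * b) ∧
      ∃ n : ℕ, C (s ^ n) ∈ Ideal.span (Set.range a) := by
  obtain ⟨G, H, hHG, hG⟩ := h
  have hGH := mul_eq_one_comm.1 hHG
  let ψ : R[X] →+* L[X] := mapRingHom φ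
  have hψ : Function.Injective ψ := map_injective _ hφ
  let κ : R →+* L[X] := ψ.comp C
  have hκA : ∀ c, κ c ∈ A.map ψ := fun c => ⟨C c, hC c, rfl⟩
  let D : Subring L[X] := (A.map ψ).fractions (T.map κ) (by rintro _ ⟨t, -, rfl⟩; exact hκA t)
  let U : Subring L[X] := ψ.range.fractions ((Submonoid.powers s).map κ)
    (by rintro _ ⟨t, -, rfl⟩; exact ⟨_, rfl⟩)
  have hκD : ∀ c, κ c ∈ D := fun c => Subring.le_fractions _ _ _ (hκA c)
  have hκU : ∀ c, κ c ∈ U := fun c => Subring.le_fractions _ _ _ ⟨_, rfl⟩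
  let N : AddSubgroup L[X] := D.toAddSubgroup.map (AddMonoidHom.mulLeft (κ (s ^ k)))
  have hDN : ∀ d ∈ D, ∀ n ∈ N, d * n ∈ N := by
    rintro d hd _ ⟨n, hn, rfl⟩
    exact ⟨d * n, D.mul_mem hd hn, by simp only [AddMonoidHom.coe_mulLeft]; ring⟩
  let ev : L[X] → L[X] →+* L[X] := fun z => (aeval z : L[X] →ₐ[L] L[X]).toRingHom
  let θ : L[X] →+* L[X][X] := (aeval (C X * (1 - X) : L[X][X])).toRingHom
  let θ' : L[X] →+* L[X][X] := (aeval (C X * X : L[X][X])).toRingHom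
  let P : Matrix ι ι L[X][X] := θ.mapMatrix G * (C : L[X] →+* _).mapMatrix H
  let Q : Matrix ι ι L[X][X] := θ'.mapMatrix G * (C : L[X] →+* _).mapMatrix ((ev 0).mapMatrix H)
  let Q' : Matrix ι ι L[X][X] := (C : L[X] →+* _).mapMatrix ((ev 0).mapMatrix G) * θ'.mapMatrix H
  obtain ⟨_, ⟨_, ⟨e, rfl⟩, rfl⟩, hP⟩ := exists_forall_mul_coeff_mem ((Submonoid.powers s).map κ) N
    (by rintro _ ⟨t, -, rfl⟩ n hn; exact hDN _ (hκD t) n hn) (fun g => by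
      obtain ⟨n, t, ht, p, hp⟩ := hL g
      obtain ⟨m, hm⟩ := hA p
      refine ⟨κ (s ^ (k + m + n)), ⟨_, ⟨_, rfl⟩, rfl⟩, κ (s ^ (m + n)) * g,
        ⟨κ t, ⟨t, ht, rfl⟩, ⟨_, hm, ?_⟩⟩, ?_⟩
      · rw [map_mul]
        change _ * (mapRingHom φ) p = _
        rw [hp]
        simp only [κ, ψ, RingHom.comp_apply, coe_mapRingHom, map_C, map_mul, map_pow]
        ring
      · simp only [AddMonoidHom.coe_mulLeft, map_pow]; ring)
    (fun i : ι × ι => P i.1 i.2)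
  obtain ⟨_, ⟨t, ht, rfl⟩, hQ⟩ := exists_forall_mul_coeff_mem (T.map κ) U.toAddSubgroup
    (by rintro _ ⟨t, -, rfl⟩ n hn; exact U.mul_mem (hκU t) hn) (fun g => by
      obtain ⟨n, t, ht, hp⟩ := hL g
      refine ⟨κ t, ⟨t, ht, rfl⟩, κ (s ^ n), ⟨_, ⟨_, rfl⟩, rfl⟩, ?_⟩
      rw [← mul_assoc, ← map_mul]
      simpa only [κ, ψ, RingHom.comp_apply, coe_mapRingHom, map_C] using hp)
    (Sum.elim (fun i : ι × ι => Q i.1 i.2) fun i : ι × ι => Q' i.1 i.2)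
  obtain ⟨l, μ, hlμ⟩ := (hT t ht).pow_left (m := e)
  have hμt : κ (μ * t) = 1 - κ (s ^ e) * κ l := by
    rw [← map_mul, ← map_one κ, ← map_sub, ← hlμ]; congr 1; ring
  let v : ι → L[X] := fun i => C (φ ((f i).eval 0))
  let Gw := (ev (κ (μ * t) * X)).mapMatrix G
  let Hw := (ev (κ (μ * t) * X)).mapMatrix H
  let G₀ := (ev 0).mapMatrix G
  let H₀ := (ev 0).mapMatrix H
  have hHGw : Hw * Gw = 1 := by rw [← map_mul, hHG, map_one]
  have hHG₀ : H₀ * G₀ = 1 := by rw [← map_mul, hHG, map_one]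
  have hGH₀ : G₀ * H₀ = 1 := by rw [← map_mul, hGH, map_one]
  have hv : H.mulVec (fun i => (f i).map φ) = v := by
    rw [← hG, Matrix.mulVec_mulVec, hHG, Matrix.one_mulVec]
  have hv₀ : G₀.mulVec v = v := by
    have h1 : (fun i => ev 0 (C (φ ((f i).eval 0)))) = v := by ext1 i; simp [ev, v]
    have h2 := (ev 0).map_mulVec_eq G v
    rw [h1] at h2
    refine h2.trans ?_
    ext1 i
    rw [show G.mulVec v = fun i => (f i).map φ from hG]
    simp [ev, v, aeval_def, eval₂_at_zero, coeff_zero_eq_eval_zero]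
  let a := Gw.mulVec v
  have haN : ∀ i, a i - (f i).map φ ∈ N := by
    intro i
    let σ : L[X][X] →+* L[X] := evalRingHom (κ (s ^ e) * κ l)
    have hσθ : σ.comp θ = ev (κ (μ * t) * X) := by
      rw [hμt]; ext <;> simp [σ, θ, ev, mul_comm]
    have hσC : σ.comp C = RingHom.id _ := by ext <;> simp [σ]
    have hcθ : (constantCoeff : L[X][X] →+* L[X]).comp θ = RingHom.id _ := by
      ext <;> simp [θ]
    have hcC : (constantCoeff : L[X][X] →+* L[X]).comp C = RingHom.id _ := by ext <;> simp
    have hσP : σ.mapMatrix P = Gw * H := by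
      rw [map_mul]
      change (σ.comp θ).mapMatrix G * (σ.comp C).mapMatrix H = _
      rw [hσθ, hσC]
      simp [Gw]
    have hP₀ : (constantCoeff : L[X][X] →+* L[X]).mapMatrix P = 1 := by
      rw [map_mul]
      change (constantCoeff.comp θ).mapMatrix G * (constantCoeff.comp C).mapMatrix H = _
      rw [hcθ, hcC]
      simpa using hGH
    have h1 : a = (Gw * H).mulVec fun i => (f i).map φ := by
      rw [← Matrix.mulVec_mulVec, hv]
    have h2 : a - (fun i => (f i).map φ) = (Gw * H - 1).mulVec fun i => (f i).map φ := by
      rw [Matrix.sub_mulVec, Matrix.one_mulVec, h1]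
    have h3 := congrFun h2 i
    rw [Pi.sub_apply] at h3
    rw [h3]
    refine N.sum_mem fun j _ => ?_
    rw [mul_comm]
    refine hDN _ (Subring.le_fractions _ _ _ ⟨f j, hf j, rfl⟩) _ ?_
    have h4 := eval_mul_sub_coeff_zero_mem D N hDN (hκD _) (hκD l) (hP (i, j))
    have h5 := congrFun (congrFun hσP i) j
    have h6 := congrFun (congrFun hP₀ i) j
    change (Gw * H - 1) i j ∈ N
    rw [Matrix.sub_apply, ← h5, ← h6]
    exact h4
  let σ : L[X][X] →+* L[X] := evalRingHom (κ t * κ μ)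
  have hσθ : σ.comp θ' = ev (κ (μ * t) * X) := by
    rw [mul_comm μ, map_mul]
    ext
    · simp [σ, θ', ev]
    · simp only [σ, θ', ev, RingHom.comp_apply, AlgHom.toRingHom_eq_coe, RingHom.coe_coe, aeval_X,
        coe_evalRingHom, eval_mul, eval_C, eval_X, mul_comm]
  have hσC : σ.comp C = RingHom.id _ := by ext <;> simp [σ]
  have hcθ : (constantCoeff : L[X][X] →+* L[X]).comp θ' = ev 0 := by
    ext <;> simp [θ', ev]
  have hcC : (constantCoeff : L[X][X] →+* L[X]).comp C = RingHom.id _ := by ext <;> simp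
  have hσQ : σ.mapMatrix Q = Gw * H₀ := by
    rw [map_mul]
    change (σ.comp θ').mapMatrix G * (σ.comp C).mapMatrix H₀ = _
    rw [hσθ, hσC]
    simp [Gw]
  have hσQ' : σ.mapMatrix Q' = G₀ * Hw := by
    rw [map_mul]
    change (σ.comp C).mapMatrix G₀ * (σ.comp θ').mapMatrix H = _
    rw [hσθ, hσC]
    simp [Hw]
  have hQ₀ : (constantCoeff : L[X][X] →+* L[X]).mapMatrix Q = 1 := by
    rw [map_mul]
    change (constantCoeff.comp θ').mapMatrix G * (constantCoeff.comp C).mapMatrix H₀ = _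
    rw [hcθ, hcC]
    exact hGH₀
  have hQ'₀ : (constantCoeff : L[X][X] →+* L[X]).mapMatrix Q' = 1 := by
    rw [map_mul]
    change (constantCoeff.comp C).mapMatrix G₀ * (constantCoeff.comp θ').mapMatrix H = _
    rw [hcθ, hcC]
    exact hGH₀
  have hUmem : ∀ p : L[X][X], (∀ j, κ t * p.coeff j ∈ U) → constantCoeff p ∈ U → σ p ∈ U := by
    intro p hp h0
    have h1 := eval_mul_sub_coeff_zero_mem U U.toAddSubgroup
      (fun d hd n hn => U.mul_mem hd hn) (hκU t) (hκU μ) hp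
    have h2 := U.add_mem h1 h0
    rwa [constantCoeff_apply, sub_add_cancel] at h2
  have hone : ∀ i j, (1 : Matrix ι ι L[X]) i j ∈ U := by
    intro i j
    rw [Matrix.one_apply]
    split_ifs
    exacts [U.one_mem, U.zero_mem]
  have hQU : ∀ i j, (Gw * H₀) i j ∈ U := by
    intro i j
    rw [← hσQ]
    refine hUmem _ (hQ (Sum.inl (i, j))) ?_
    have := congrFun (congrFun hQ₀ i) j
    rw [RingHom.mapMatrix_apply, Matrix.map_apply] at this
    rw [this]; exact hone i j
  have hQU' : ∀ i j, (G₀ * Hw) i j ∈ U := by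
    intro i j
    rw [← hσQ']
    refine hUmem _ (hQ (Sum.inr (i, j))) ?_
    have := congrFun (congrFun hQ'₀ i) j
    rw [RingHom.mapMatrix_apply, Matrix.map_apply] at this
    rw [this]; exact hone i j
  have hvκ : ∀ i, v i = κ ((f i).eval 0) := fun i => by simp [v, κ, ψ]
  have haU : ∀ i, a i ∈ U := by
    intro i
    have h1 : (Gw * H₀).mulVec (G₀.mulVec v) = a := by
      rw [Matrix.mulVec_mulVec, Matrix.mul_assoc, hHG₀, Matrix.mul_one]
    rw [← h1, hv₀]
    exact U.sum_mem fun j _ => U.mul_mem (hQU i j) (hvκ j ▸ hκU _)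
  have hva : v = (G₀ * Hw).mulVec a := by
    rw [Matrix.mulVec_mulVec, Matrix.mul_assoc, hHGw, Matrix.mul_one, hv₀]
  have hdesc : ∀ i, ∃ b ∈ A, a i = ψ (f i + C (s ^ k) * b) := by
    intro i
    obtain ⟨d, ⟨_, ⟨u, hu, rfl⟩, hd⟩, hda⟩ := haN i
    obtain ⟨_, ⟨_, ⟨n, rfl⟩, rfl⟩, p, hp⟩ :=
      U.sub_mem (haU i) (Subring.le_fractions _ _ _ ⟨f i, rfl⟩ : ψ (f i) ∈ U)
    obtain ⟨m, hm⟩ := hA p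
    obtain ⟨c, c', hcc⟩ := (hT u hu).pow_left (m := m + n + k)
    simp only [AddMonoidHom.coe_mulLeft] at hda
    have h1 : κ (s ^ (m + n + k)) * d = ψ (C (s ^ m) * p) := by
      rw [map_mul, hp]
      change _ = κ (s ^ m) * (κ (s ^ n) * (a i - (f i).map φ))
      rw [← hda]
      simp only [map_pow]; ring
    have h2 : d ∈ A.map ψ := by
      have : d = κ c * ψ (C (s ^ m) * p) + κ c' * (κ u * d) := by
        rw [← h1]
        calc d = κ (c * s ^ (m + n + k) + c' * u) * d := by rw [hcc, map_one, one_mul]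
          _ = _ := by rw [map_add, map_mul, map_mul]; ring
      rw [this]
      exact Subring.add_mem _ (Subring.mul_mem _ (hκA _) ⟨_, hm, rfl⟩)
        (Subring.mul_mem _ (hκA _) hd)
    obtain ⟨b, hb, rfl⟩ := h2
    refine ⟨b, hb, ?_⟩
    rw [map_add, map_mul]
    change a i = (f i).map φ + κ (s ^ k) * ψ b
    rw [hda]; ring
  choose b hb hab using hdesc
  refine ⟨fun i => f i + C (s ^ k) * b i, fun i => ⟨b i, hb i, rfl⟩, ?_⟩
  obtain ⟨c, hc⟩ := (Ideal.mem_span_range_iff_exists_fun).1 hn₀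
  have hκc : κ (s ^ n₀) = ∑ j, (∑ i, κ (c i) * (G₀ * Hw) i j) * a j := by
    rw [← hc, map_sum]
    simp only [Finset.sum_mul]
    rw [Finset.sum_comm]
    refine Finset.sum_congr rfl fun i _ => ?_
    rw [map_mul, ← hvκ, hva]
    simp only [Matrix.mulVec, dotProduct, Finset.mul_sum, mul_assoc]
  have hU' : ∀ (u : ι → L[X]), (∀ j, u j ∈ U) → ∃ n : ℕ, ∀ j, κ (s ^ n) * u j ∈ ψ.range := by
    intro u hu
    choose t' ht' htu using hu
    choose t'' ht'' htt using ht'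
    choose n hn using ht''
    refine ⟨∑ j, n j, fun j => ?_⟩
    rw [← Finset.sum_erase_add _ _ (Finset.mem_univ j), pow_add, map_mul, mul_assoc]
    refine ψ.range.mul_mem ⟨_, rfl⟩ ?_
    have := htu j
    rwa [← htt j, ← hn j] at this
  obtain ⟨n, hn⟩ := hU' _ fun j => U.sum_mem fun i _ => U.mul_mem (hκU (c i)) (hQU' i j)
  choose w hw using hn
  refine ⟨n + n₀, Ideal.mem_span_range_iff_exists_fun.2 ⟨w, hψ ?_⟩⟩
  rw [map_sum]
  change _ = κ (s ^ (n + n₀))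
  rw [pow_add, map_mul, hκc, Finset.mul_sum]
  refine Finset.sum_congr rfl fun j _ => ?_
  rw [map_mul, hw, ← hab, mul_assoc]

end Patching

section RowLemma

lemma exists_finset_height_add_one_le {A B : Type*} [CommRing A] [CommRing B] [IsNoetherianRing B]
    (j : A →+* B) (σ : A) (t : Set B) (n : ℕ)
    (ht : ∀ Q : Ideal B, Q.IsPrime → j σ ∉ Q → t ⊆ Q → n ≤ Q.height) :
    ∃ F : Finset (PrimeSpectrum A), (∀ P ∈ F, σ ∉ P.asIdeal) ∧
      ∀ a, (∀ P ∈ F, a ∉ P.asIdeal) → ∀ Q : Ideal B, Q.IsPrime → j σ ∉ Q → t ⊆ Q → j a ∈ Q →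
        ((n + 1 : ℕ) : ℕ∞) ≤ Q.height := by
  classical
  have hfin : {P : PrimeSpectrum B | P.asIdeal ∈ (Ideal.span t).minimalPrimes ∧
      j σ ∉ P.asIdeal}.Finite :=
    ((Ideal.finite_minimalPrimes_of_isNoetherianRing B (Ideal.span t)).preimage
      (f := PrimeSpectrum.asIdeal) (fun P _ Q _ h => PrimeSpectrum.ext h)).subset fun P hP => hP.1
  refine ⟨hfin.toFinset.image (PrimeSpectrum.comap j), fun P hP => ?_,
    fun a ha Q hQ hσ ht' haQ => ?_⟩
  · obtain ⟨Q, hQ, rfl⟩ := Finset.mem_image.1 hP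
    exact (hfin.mem_toFinset.1 hQ).2
  · obtain ⟨Q', hQ', hle⟩ := Ideal.exists_minimalPrimes_le (Ideal.span_le.2 ht')
    have := hQ'.1.1
    have hσ' : j σ ∉ Q' := fun h => hσ (hle h)
    have ha' : j a ∉ Q' := ha _ (Finset.mem_image_of_mem _
      (hfin.mem_toFinset.2 (show (⟨Q', this⟩ : PrimeSpectrum B) ∈ _ from ⟨hQ', hσ'⟩)))
    have h1 := ht Q' this hσ' fun x hx => hQ'.1.2 (Ideal.subset_span hx)
    have h2 := Ideal.height_add_one_le_of_lt_of_isPrime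
      (lt_of_le_of_ne hle fun h => ha' (h ▸ haQ))
    push_cast
    exact (add_le_add_left h1 1).trans h2

lemma exists_family_le_height {A B₁ B₂ : Type*} [CommRing A] [CommRing B₁] [CommRing B₂]
    [IsNoetherianRing B₁] [IsNoetherianRing B₂] (j₁ : A →+* B₁) (j₂ : A →+* B₂) (σ a₀ : A) (k : ℕ)
    (h₁ : ∀ Q : Ideal B₁, Q.IsPrime → j₁ σ ∉ Q → j₁ a₀ ∈ Q → 1 ≤ Q.height)
    (h₂ : ∀ Q : Ideal B₂, Q.IsPrime → j₂ σ ∉ Q → j₂ a₀ ∈ Q → 1 ≤ Q.height)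
    (n : ℕ) (f : Fin (n + 1) → A) (hf : f 0 = a₀) :
    ∃ g : Fin (n + 1) → A, g 0 = a₀ ∧ (∀ i, ∃ b, g i = f i + σ ^ k * b) ∧
      (∀ Q : Ideal B₁, Q.IsPrime → j₁ σ ∉ Q → (∀ i, j₁ (g i) ∈ Q) →
        ((n + 1 : ℕ) : ℕ∞) ≤ Q.height) ∧
      (∀ Q : Ideal B₂, Q.IsPrime → j₂ σ ∉ Q → (∀ i, j₂ (g i) ∈ Q) →
        ((n + 1 : ℕ) : ℕ∞) ≤ Q.height) := by
  classical
  induction n with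
  | zero =>
    refine ⟨f, hf, fun i => ⟨0, by simp⟩, fun Q hQ hσ hi => ?_, fun Q hQ hσ hi => ?_⟩
    · simpa using h₁ Q hQ hσ (hf ▸ hi 0)
    · simpa using h₂ Q hQ hσ (hf ▸ hi 0)
  | succ n ih =>
    obtain ⟨g, hg₀, hgf, hg₁, hg₂⟩ := ih (fun i => f i.castSucc) hf
    obtain ⟨F₁, hF₁, h₁'⟩ := exists_finset_height_add_one_le j₁ σ (Set.range fun i => j₁ (g i))
      (n + 1) fun Q hQ hσ ht => hg₁ Q hQ hσ fun i => ht ⟨i, rfl⟩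
    obtain ⟨F₂, hF₂, h₂'⟩ := exists_finset_height_add_one_le j₂ σ (Set.range fun i => j₂ (g i))
      (n + 1) fun Q hQ hσ ht => hg₂ Q hQ hσ fun i => ht ⟨i, rfl⟩
    obtain ⟨b, hb, hF⟩ := exists_add_notMem (F₁ ∪ F₂) (Ideal.span {σ ^ k}) (f (Fin.last _))
      fun P hP => Or.inr fun hle => by
        have := P.2.mem_of_pow_mem _ (hle (Ideal.mem_span_singleton_self _))
        rcases Finset.mem_union.1 hP with h | h
        exacts [hF₁ P h this, hF₂ P h this]
    obtain ⟨b, rfl⟩ := Ideal.mem_span_singleton'.1 hb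
    refine ⟨Fin.snoc g (f (Fin.last _) + b * σ ^ k), ?_, fun i => ?_, fun Q hQ hσ hi => ?_,
      fun Q hQ hσ hi => ?_⟩
    · rw [← Fin.castSucc_zero, Fin.snoc_castSucc, hg₀]
    · induction i using Fin.lastCases with
      | last => exact ⟨b, by rw [Fin.snoc_last, mul_comm]⟩
      | cast i => simpa only [Fin.snoc_castSucc] using hgf i
    · refine h₁' _ (fun P hP => hF P (Finset.mem_union_left _ hP)) Q hQ hσ ?_ ?_
      · rintro _ ⟨i, rfl⟩
        simpa only [Fin.snoc_castSucc, SetLike.mem_coe] using hi i.castSucc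
      · simpa only [Fin.snoc_last] using hi (Fin.last _)
    · refine h₂' _ (fun P hP => hF P (Finset.mem_union_right _ hP)) Q hQ hσ ?_ ?_
      · rintro _ ⟨i, rfl⟩
        simpa only [Fin.snoc_castSucc, SetLike.mem_coe] using hi i.castSucc
      · simpa only [Fin.snoc_last] using hi (Fin.last _)

lemma one_le_height_of_mem {B : Type*} [CommRing B] [IsDomain B] {x : B} (hx : x ≠ 0)
    {Q : Ideal B} [Q.IsPrime] (h : x ∈ Q) : 1 ≤ Q.height := by
  have hlt : (⊥ : Ideal B) < Q := bot_lt_iff_ne_bot.2 fun h0 => hx (by simpa [h0] using h)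
  simpa using Ideal.height_add_one_le_of_lt_of_isPrime hlt

lemma one_le_dim_of_not_isUnit {R : Type*} [CommRing R] [IsDomain R] {s : R} (hs : s ≠ 0)
    (hs' : ¬ IsUnit s) : 1 ≤ ringKrullDim R := by
  obtain ⟨m, hm, hsm⟩ := exists_max_ideal_of_mem_nonunits hs'
  refine le_trans ?_ (Ideal.height_le_ringKrullDim_of_ne_top hm.ne_top)
  exact_mod_cast one_le_height_of_mem hs hsm

/-- The elements congruent to `1` modulo `s`. -/
def oneAddMultiples {R : Type*} [CommRing R] (s : R) : Submonoid R :=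
  (⊥ : Submonoid (R ⧸ Ideal.span {s})).comap (Ideal.Quotient.mk (Ideal.span {s}))

lemma mem_oneAddMultiples {R : Type*} [CommRing R] {s t : R} :
    t ∈ oneAddMultiples s ↔ ∃ a, a * s = t - 1 := by
  rw [oneAddMultiples, Submonoid.mem_comap, Submonoid.mem_bot, ← map_one (Ideal.Quotient.mk _),
    Ideal.Quotient.eq, Ideal.mem_span_singleton']

lemma height_le_ringKrullDim_of_isMaximal {R L : Type*} [CommRing R] [IsNoetherianRing R] {s : R}
    [CommRing L] [Algebra R L] [IsLocalization (Submonoid.powers s ⊔ oneAddMultiples s) L]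
    (P : Ideal L[X]) [hP : P.IsMaximal] : (P.height : WithBot ℕ∞) ≤ ringKrullDim R := by
  set S := Submonoid.powers s ⊔ oneAddMultiples s
  have : IsNoetherianRing L := IsLocalization.isNoetherianRing S L inferInstance
  let q : Ideal L := P.under L
  have hq : q.IsPrime := inferInstance
  have : P.LiesOver q := ⟨rfl⟩
  rw [Polynomial.height_eq_height_add_one q P, ← IsLocalization.height_under S q]
  set p := q.under R
  have hdisj : ∀ x ∈ S, x ∉ p := fun x hx hxp =>
    hq.ne_top (Ideal.eq_top_of_isUnit_mem _ hxp (IsLocalization.map_units L ⟨x, hx⟩))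
  have hsS : s ∈ S := Submonoid.mem_sup_left (Submonoid.mem_powers s)
  have hne : p ⊔ Ideal.span {s} ≠ ⊤ := fun h => by
    obtain ⟨x, hx, y, hy, hxy⟩ := Submodule.mem_sup.1 ((Ideal.eq_top_iff_one _).1 h)
    obtain ⟨a, rfl⟩ := Ideal.mem_span_singleton'.1 hy
    refine hdisj x (Submonoid.mem_sup_right (mem_oneAddMultiples.2 ⟨-a, ?_⟩)) hx
    rw [← hxy]; ring
  obtain ⟨m, hm, hle⟩ := Ideal.exists_le_maximal _ hne
  have hlt : p < m := lt_of_le_of_ne (le_sup_left.trans hle) fun h => hdisj s hsS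
    (h ▸ hle (Ideal.mem_sup_right (Ideal.mem_span_singleton_self s)))
  have h1 := Ideal.height_add_one_le_of_lt_of_isPrime hlt
  refine le_trans ?_ (Ideal.height_le_ringKrullDim_of_ne_top hm.ne_top)
  exact_mod_cast h1

/-- Rows with entries in `A` of length greater than `dim R` can be modified modulo `s ^ k` so as to
become unimodular after inverting `s`. -/
theorem exists_row {R : Type*} [CommRing R] [IsDomain R] [IsNoetherianRing R] (A : Subring R[X])
    (hC : ∀ c, C c ∈ A) {s : R} (hs : s ≠ 0) (hA : ∀ f : R[X], ∃ n : ℕ, C (s ^ n) * f ∈ A)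
    {r : ℕ} (hr : ringKrullDim R + 1 ≤ r) (k : ℕ) (f : Fin r → R[X]) (hf : ∀ i, f i ∈ A) :
    ∃ a : Fin r → R[X], (∀ i, ∃ b ∈ A, a i = f i + C (s ^ k) * b) ∧
      ∃ n : ℕ, C (s ^ n) ∈ Ideal.span (Set.range a) := by
  have hdim : 0 ≤ ringKrullDim R := ringKrullDim_nonneg_of_nontrivial
  by_cases hu : IsUnit s
  · have hAtop : ∀ g, g ∈ A := fun g => by
      obtain ⟨n, hn⟩ := hA g
      have := A.mul_mem (hC ((hu.pow n).unit⁻¹ : Rˣ)) hn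
      rwa [← mul_assoc, ← map_mul, IsUnit.val_inv_mul, map_one, one_mul] at this
    have hr0 : 0 < r := by
      by_contra! h0
      obtain rfl : r = 0 := by omega
      have : (1 : WithBot ℕ∞) ≤ 0 := le_trans (by simpa using add_le_add_left hdim 1) hr
      exact absurd this (by decide)
    refine ⟨fun _ => 1, fun i => ⟨C ((hu.pow k).unit⁻¹ : Rˣ).1 * (1 - f i), hAtop _, ?_⟩, 0, ?_⟩
    · beta_reduce
      rw [← mul_assoc, ← map_mul, IsUnit.mul_val_inv, map_one, one_mul, add_sub_cancel]
    · rw [pow_zero, map_one]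
      exact Ideal.subset_span ⟨⟨0, hr0⟩, rfl⟩
  have h1 := one_le_dim_of_not_isUnit hs hu
  obtain ⟨n, rfl⟩ : ∃ n, r = n + 1 + 1 := by
    have : (1 : WithBot ℕ∞) + 1 ≤ r := (add_le_add_left h1 1).trans hr
    have : 1 + 1 ≤ r := by exact_mod_cast this
    exact ⟨r - 2, by omega⟩
  set S := Submonoid.powers s ⊔ oneAddMultiples s with hS
  have hsup : ∀ c ∈ S, ∃ n : ℕ, ∃ t ∈ oneAddMultiples s, c = s ^ n * t := fun c hc => by
    obtain ⟨_, ⟨n, rfl⟩, t, ht, rfl⟩ := Submonoid.mem_sup.1 hc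
    exact ⟨n, t, ht, rfl⟩
  have hcop : ∀ t ∈ oneAddMultiples s, IsCoprime s t := fun t ht => by
    obtain ⟨a, ha⟩ := mem_oneAddMultiples.1 ht
    exact ⟨-a, 1, by linear_combination -ha⟩
  have hS0 : S ≤ nonZeroDivisors R := le_nonZeroDivisors_of_noZeroDivisors fun h0 => by
    obtain ⟨n, t, ht, h⟩ := hsup 0 h0
    rcases mul_eq_zero.1 h.symm with h | rfl
    · exact hs (eq_zero_of_pow_eq_zero h)
    · exact hu (isCoprime_zero_right.1 (hcop 0 ht))
  let L := Localization S
  have : IsDomain L := IsLocalization.isDomain_localization hS0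
  have : IsNoetherianRing L := IsLocalization.isNoetherianRing S L inferInstance
  have hφ : Function.Injective (algebraMap R L) := IsLocalization.injective L hS0
  set φ := algebraMap R L
  obtain ⟨ε, hε⟩ : ∃ ε : R, (f 0).eval 0 + s ^ k * ε ≠ 0 := by
    by_cases h0 : (f 0).eval 0 = 0
    · exact ⟨1, by simpa [h0] using fun h => (hs h).elim⟩
    · exact ⟨0, by simpa using h0⟩
  set D := (f 0).natDegree + 1 with hD
  obtain ⟨m, hm⟩ := hA (X ^ D)
  set b₀ : R[X] := C ε + C (s ^ m) * X ^ D with hb₀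
  have hb₀A : b₀ ∈ A := A.add_mem (hC ε) hm
  set a₀ : R[X] := f 0 + C (s ^ k) * b₀ with ha₀
  have ha₀A : a₀ ∈ A := A.add_mem (hf 0) (A.mul_mem (hC _) hb₀A)
  have hlead : a₀.leadingCoeff = s ^ (k + m) := by
    have h2 : a₀ = (f 0 + C (s ^ k * ε)) + C (s ^ (k + m)) * X ^ D := by
      rw [ha₀, hb₀, pow_add s, C_mul, C_mul]
      ring
    rw [h2, leadingCoeff_add_of_degree_lt, leadingCoeff_C_mul_X_pow]
    rw [degree_C_mul_X_pow _ (pow_ne_zero _ hs)]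
    refine degree_le_natDegree.trans_lt (Nat.cast_lt.2 ?_)
    rw [natDegree_add_C]
    exact Nat.lt_succ_self _
  have heval : a₀.eval 0 ≠ 0 := by
    rw [ha₀, hb₀]
    simpa [hD] using hε
  have hmap : (a₀.map φ).leadingCoeff = φ (s ^ (k + m)) := by
    rw [leadingCoeff_map_of_injective hφ, hlead]
  have hsu : IsUnit (φ s) :=
    IsLocalization.map_units L (⟨s, Submonoid.mem_sup_left (Submonoid.mem_powers s)⟩ : S)
  have hlu : IsUnit (a₀.map φ).leadingCoeff := by
    rw [hmap, map_pow]
    exact hsu.pow _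
  obtain ⟨g, hg₀, hgf, hg₁, hg₂⟩ := exists_family_le_height ((mapRingHom φ).comp A.subtype)
    ((evalRingHom 0).comp A.subtype) ⟨C s, hC s⟩ ⟨a₀, ha₀A⟩ k
    (fun Q hQ _ h => one_le_height_of_mem (leadingCoeff_ne_zero.1 hlu.ne_zero) h)
    (fun Q hQ _ h => one_le_height_of_mem heval h) (n + 1)
    (Function.update (fun i => ⟨f i, hf i⟩) 0 ⟨a₀, ha₀A⟩) (Function.update_self _ _ _)
  have hcontra : ¬ ((n + 1 + 1 : ℕ) : WithBot ℕ∞) ≤ ringKrullDim R := fun h => by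
    have h3 := (add_le_add_left h 1).trans hr
    have : n + 1 + 1 + 1 ≤ n + 1 + 1 := by exact_mod_cast h3
    omega
  have hspan : Ideal.span (Set.range fun i => (g i : R[X]).map φ) = ⊤ := by
    by_contra hne
    obtain ⟨P, hP, hle⟩ := Ideal.exists_le_maximal _ hne
    refine hcontra (le_trans ?_ (height_le_ringKrullDim_of_isMaximal (s := s) P))
    have := hg₁ P hP.isPrime (fun h => hP.ne_top (Ideal.eq_top_of_isUnit_mem _ h
      (by simpa using hsu))) fun i => hle (Ideal.subset_span ⟨i, rfl⟩)
    exact_mod_cast this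
  obtain ⟨n₀, hn₀⟩ : ∃ n₀ : ℕ, s ^ n₀ ∈ Ideal.span (Set.range fun i => (g i : R[X]).eval 0) := by
    by_contra! hne
    obtain ⟨P, hP, hle, hdisj⟩ := Ideal.exists_le_prime_disjoint
      (Ideal.span (Set.range fun i => (g i : R[X]).eval 0)) (Submonoid.powers s)
      (Set.disjoint_left.2 fun x hx hx' => by
        obtain ⟨l, rfl⟩ := hx'
        exact hne l hx)
    refine hcontra (le_trans ?_ (Ideal.height_le_ringKrullDim_of_ne_top hP.ne_top))
    have := hg₂ P hP (fun h => Set.disjoint_left.1 hdisj (by simpa using h)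
      (Submonoid.mem_powers s)) fun i => hle (Ideal.subset_span ⟨i, rfl⟩)
    exact_mod_cast this
  have hGL := GLEquiv.horrocks hspan (i := 0) (j := 1) (by simp) (by simpa only [hg₀] using hlu)
  have hev : ∀ l, ((g l : R[X]).map φ).eval 0 = φ ((g l : R[X]).eval 0) := fun l => by
    rw [← map_zero φ, eval_map_apply]
  simp only [hev] at hGL
  obtain ⟨a, ha, hn⟩ := exists_mem_of_glEquiv φ hφ A hC hA (oneAddMultiples s) hcop
    (fun p => by
      obtain ⟨c, hc, h⟩ := Localization.exists_C_mul_mem_range S p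
      obtain ⟨l, t, ht, rfl⟩ := hsup c hc
      exact ⟨l, t, ht, h⟩) (fun i => (g i).2) hn₀ hGL k
  refine ⟨a, fun i => ?_, hn⟩
  obtain ⟨b, hb, hab⟩ := ha i
  obtain ⟨b', hb'⟩ := hgf i
  have hg : (g i : R[X]) =
      (Function.update (fun i => (⟨f i, hf i⟩ : A)) 0 ⟨a₀, ha₀A⟩ i : A) +
      C (s ^ k) * (b' : R[X]) := by
    rw [hb']
    simp
  rcases eq_or_ne i 0 with rfl | hi
  · refine ⟨b₀ + b' + b, A.add_mem (A.add_mem hb₀A b'.2) hb, ?_⟩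
    rw [hab, hg, Function.update_self]
    simp only [ha₀]
    ring
  · refine ⟨b' + b, A.add_mem b'.2 hb, ?_⟩
    rw [hab, hg, Function.update_of_ne hi]
    ring

end RowLemma

section FiberDimension

variable {A : Type*} [CommRing A] {M : Type*} [AddCommGroup M] [Module A M]

lemma minNumGens_le_spanFinrank {B N : Type*} [CommRing B] [AddCommGroup N] [Module B N]
    [Module.Finite B N] : minNumGens B N ≤ (⊤ : Submodule B N).spanFinrank := by
  obtain ⟨s, hs⟩ := Submodule.FG.exists_span_finset_card_eq_spanFinrank
    (Module.Finite.fg_top (R := B) (M := N))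
  exact Nat.sInf_le ⟨s, hs⟩

/-- The base change of `M` to an algebra over `A_P` computed from the localization of `M` at `P`. -/
noncomputable def localizedBaseChangeEquiv (P : Ideal A) [P.IsPrime] (F : Type*) [CommRing F]
    [Algebra A F] [Algebra (Localization P.primeCompl) F]
    [IsScalarTower A (Localization P.primeCompl) F] :
    F ⊗[Localization P.primeCompl] LocalizedModule P.primeCompl M ≃ₗ[F] F ⊗[A] M :=
  (TensorProduct.AlgebraTensorModule.congr (LinearEquiv.refl _ _)
    ((isLocalizedModule_iff_isBaseChange P.primeCompl (Localization P.primeCompl)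
      (LocalizedModule.mkLinearMap P.primeCompl M)).1 inferInstance).equiv.symm).trans
    (TensorProduct.AlgebraTensorModule.cancelBaseChange A (Localization P.primeCompl) F F M)

lemma localizedBaseChangeEquiv_one_tmul (P : Ideal A) [P.IsPrime] (F : Type*) [CommRing F]
    [Algebra A F] [Algebra (Localization P.primeCompl) F]
    [IsScalarTower A (Localization P.primeCompl) F] (m : M) :
    localizedBaseChangeEquiv P F (1 ⊗ₜ LocalizedModule.mkLinearMap P.primeCompl M m) =
      1 ⊗ₜ m := by
  have h : ((isLocalizedModule_iff_isBaseChange P.primeCompl (Localization P.primeCompl)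
      (LocalizedModule.mkLinearMap P.primeCompl M)).1 inferInstance).equiv.symm
      (LocalizedModule.mkLinearMap P.primeCompl M m) = 1 ⊗ₜ m := by
    rw [LinearEquiv.symm_apply_eq, IsBaseChange.equiv_tmul, one_smul]
  rw [localizedBaseChangeEquiv, LinearEquiv.trans_apply,
    TensorProduct.AlgebraTensorModule.congr_tmul, h]
  simp

lemma spanFinrank_localizedModule_eq [Module.Finite A M] (P : Ideal A) [P.IsPrime] :
    (⊤ : Submodule (Localization P.primeCompl) (LocalizedModule P.primeCompl M)).spanFinrank =
      Module.finrank P.ResidueField (P.ResidueField ⊗[A] M) := by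
  rw [← TensorProduct.spanFinrank_top_eq_of_residueField _ Module.Finite.fg_top,
    ← Module.finrank_eq_spanFinrank_of_free]
  exact ((TensorProduct.AlgebraTensorModule.congr (LinearEquiv.refl _ _)
    Submodule.topEquiv).trans (localizedBaseChangeEquiv P P.ResidueField)).finrank_eq

lemma finrank_fiber_le_of_le [Module.Finite A M] {p P : Ideal A} [p.IsPrime] [P.IsPrime]
    (h : p ≤ P) : Module.finrank p.ResidueField (p.ResidueField ⊗[A] M) ≤
      Module.finrank P.ResidueField (P.ResidueField ⊗[A] M) := by
  let ρ : Localization P.primeCompl →+* p.ResidueField :=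
    IsLocalization.lift (M := P.primeCompl) (g := algebraMap A p.ResidueField) fun a =>
      isUnit_iff_ne_zero.2 fun h0 => a.2 (h (Ideal.algebraMap_residueField_eq_zero.1 h0))
  let : Algebra (Localization P.primeCompl) p.ResidueField := ρ.toAlgebra
  have : IsScalarTower A (Localization P.primeCompl) p.ResidueField :=
    .of_algebraMap_eq fun a => (IsLocalization.lift_eq _ a).symm
  rw [← spanFinrank_localizedModule_eq P]
  refine le_trans (le_of_eq ?_) (TensorProduct.spanFinrank_top_le_of_fg (A := p.ResidueField)
    (⊤ : Submodule (Localization P.primeCompl) (LocalizedModule P.primeCompl M))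
    Module.Finite.fg_top)
  rw [← Module.finrank_eq_spanFinrank_of_free]
  exact ((TensorProduct.AlgebraTensorModule.congr (LinearEquiv.refl _ _)
    Submodule.topEquiv).trans (localizedBaseChangeEquiv P p.ResidueField)).finrank_eq.symm

lemma muP_le_finrank [Module.Finite A M] (P : Ideal A) (hP : P.IsPrime) :
    muP P hP M ≤ Module.finrank P.ResidueField (P.ResidueField ⊗[A] M) := by
  rw [← spanFinrank_localizedModule_eq]
  exact minNumGens_le_spanFinrank

lemma isBasicAt_of_one_tmul_ne_zero {x : M} (P : Ideal A) (hP : P.IsPrime)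
    (hx : (1 : P.ResidueField) ⊗ₜ[A] x ≠ 0) : IsBasicAt x P hP := by
  intro hmem
  refine hx ?_
  rw [← localizedBaseChangeEquiv_one_tmul P P.ResidueField]
  suffices h : ∀ z ∈ (P.map (algebraMap A (Localization P.primeCompl))) •
      (⊤ : Submodule (Localization P.primeCompl) (LocalizedModule P.primeCompl M)),
      (1 : P.ResidueField) ⊗ₜ[Localization P.primeCompl] z = 0 by
    rw [h _ hmem, map_zero]
  intro z hz
  induction hz using Submodule.smul_induction_on' with
  | smul a ha n _ =>
    have h0 : algebraMap (Localization P.primeCompl) P.ResidueField a = 0 := by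
      rw [Localization.AtPrime.map_eq_maximalIdeal] at ha
      exact (IsLocalRing.residue_eq_zero_iff a).2 ha
    rw [← TensorProduct.smul_tmul, Algebra.smul_def, h0, zero_mul, TensorProduct.zero_tmul]
  | add a _ b _ ha hb => rw [TensorProduct.tmul_add, ha, hb, add_zero]

lemma finrank_fiber_ker_eq {L : Type*} [CommRing L] [IsDomain L] [Algebra A L] (p : Ideal A)
    [p.IsPrime] (hp : RingHom.ker (algebraMap A L) = p) :
    Module.finrank p.ResidueField (p.ResidueField ⊗[A] M) = Module.finrank L (L ⊗[A] M) := by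
  let F := FractionRing L
  let κ := p.ResidueField
  have hker : ∀ a, algebraMap A F a = 0 ↔ a ∈ p := fun a => by
    rw [IsScalarTower.algebraMap_apply A L F, map_eq_zero_iff _ (IsFractionRing.injective L F),
      ← hp, RingHom.mem_ker]
  let ρ : κ →+* F := Ideal.ResidueField.lift p (algebraMap A F) (fun a ha => (hker a).2 ha)
    fun a ha => isUnit_iff_ne_zero.2 fun h => ha ((hker a).1 h)
  let : Algebra κ F := ρ.toAlgebra
  have : IsScalarTower A κ F := .of_algebraMap_eq fun a =>
    (Ideal.ResidueField.lift_algebraMap _ _ _ _ a).symm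
  have : FaithfulSMul κ F := (faithfulSMul_iff_algebraMap_injective κ F).2 ρ.injective
  have e₁ := IsBaseChange.finrank_eq (TensorProduct.isBaseChange κ (κ ⊗[A] M) F)
  have e₂ := IsBaseChange.finrank_eq (TensorProduct.isBaseChange L (L ⊗[A] M) F)
  rw [← e₁, ← e₂]
  exact ((TensorProduct.AlgebraTensorModule.cancelBaseChange A κ F F M).trans
    (TensorProduct.AlgebraTensorModule.cancelBaseChange A L F F M).symm).finrank_eq

end FiberDimension

section Core

variable {A R : Type*} [CommRing A] [CommRing R] [IsDomain R]
  {M : Type*} [AddCommGroup M] [Module A M]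

lemma ringKrullDim_add_one_le_quotient_ker (π : A →+* R[X]) (hC : ∀ c, C c ∈ π.range) {σ₀ : R}
    (hσ₀ : σ₀ ≠ 0) (hπ : ∀ f : R[X], ∃ n : ℕ, C (σ₀ ^ n) * f ∈ π.range) :
    ringKrullDim R + 1 ≤ ringKrullDim (A ⧸ RingHom.ker π) := by
  rw [ringKrullDim_eq_of_ringEquiv π.quotientKerEquivRange]
  obtain ⟨n, hn⟩ := hπ X
  refine ringKrullDim_succ_le_of_surjective ((evalRingHom 0).comp π.range.subtype)
    (fun c => ⟨⟨C c, hC c⟩, by simp⟩) (r := ⟨_, hn⟩) (mem_nonZeroDivisors_of_ne_zero fun h => ?_)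
    (by simp)
  have h0 := congrArg Subtype.val h
  exact mul_ne_zero (C_ne_zero.2 (pow_ne_zero n hσ₀)) X_ne_zero h0

/-- The elements of `A` that `π` maps to nonzero constants. -/
noncomputable def constantSubmonoid (π : A →+* R[X]) : Submonoid A :=
  ((nonZeroDivisors R).map (C : R →+* R[X])).comap π

lemma mem_constantSubmonoid {π : A →+* R[X]} {a : A} :
    a ∈ constantSubmonoid π ↔ ∃ c : R, c ≠ 0 ∧ π a = C c := by
  simp only [constantSubmonoid, Submonoid.mem_comap, Submonoid.mem_map,
    mem_nonZeroDivisors_iff_ne_zero]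
  exact exists_congr fun c => and_congr_right fun _ => eq_comm

lemma exists_dual_family {A M L : Type*} [CommRing A] [AddCommGroup M] [Module A M]
    [Module.Finite A M] [CommRing L] [IsDomain L] [IsPrincipalIdealRing L] [Algebra A L]
    (p : Ideal A) [p.IsPrime] (hp : RingHom.ker (algebraMap A L) = p) (S : Submonoid A)
    (hS : ∀ l : L, ∃ c ∈ S, ∃ a, algebraMap A L a = c • l) {r : ℕ}
    (hr : Module.finrank p.ResidueField (p.ResidueField ⊗[A] M) = r) :
    ∃ γ ∈ S, ∃ (φ : Fin r → M →ₗ[A] A ⧸ p) (e : Fin r → M),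
      ∀ i j, φ i (e j) = if i = j then Ideal.Quotient.mk p γ else 0 := by
  classical
  let Q := (L ⊗[A] M) ⧸ Submodule.torsion L (L ⊗[A] M)
  have hQ : Module.finrank L Q = r := by
    rw [finrank_quotient_eq_of_le_torsion le_rfl, ← finrank_fiber_ker_eq p hp, hr]
  let b : Module.Basis (Fin r) L Q := Module.finBasisOfFinrankEq L Q hQ
  choose n hn using fun j => Submodule.mkQ_surjective _ (b j)
  have hclear : ∀ z : L ⊗[A] M, ∃ c ∈ S, ∃ m : M, (1 : L) ⊗ₜ[A] m = c • z := fun z => by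
    induction z using TensorProduct.induction_on with
    | zero => exact ⟨1, S.one_mem, 0, by simp⟩
    | tmul l m =>
      obtain ⟨c, hc, a, ha⟩ := hS l
      exact ⟨c, hc, a • m, by
        rw [TensorProduct.smul_tmul', ← ha, ← TensorProduct.smul_tmul,
          Algebra.algebraMap_eq_smul_one]⟩
    | add x y hx hy =>
      obtain ⟨c, hc, m, hm⟩ := hx
      obtain ⟨d, hd, m', hm'⟩ := hy
      refine ⟨c * d, S.mul_mem hc hd, d • m + c • m', ?_⟩
      rw [TensorProduct.tmul_add, TensorProduct.tmul_smul, TensorProduct.tmul_smul, hm, hm',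
        smul_add, smul_smul, smul_smul, mul_comm d c]
  choose c hc m hm using fun j => hclear (n j)
  let e : Fin r → M := fun j => (∏ i ∈ Finset.univ.erase j, c i) • m j
  have he : ∀ j, (1 : L) ⊗ₜ[A] e j = (∏ i, c i) • n j := fun j => by
    rw [TensorProduct.tmul_smul, hm, smul_smul, Finset.prod_erase_mul _ _ (Finset.mem_univ j)]
  let ψ : Fin r → M →ₗ[A] L := fun i =>
    ((b.coord i ∘ₗ Submodule.mkQ _).restrictScalars A) ∘ₗ TensorProduct.mk A L M 1
  have hψ : ∀ i j, ψ i (e j) = if i = j then algebraMap A L (∏ i, c i) else 0 := fun i j => by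
    change b.coord i (Submodule.mkQ _ (1 ⊗ₜ[A] e j)) = _
    rw [he, ← algebraMap_smul L, map_smul, map_smul, hn, b.coord_apply, b.repr_self,
      Finsupp.single_apply]
    simp [eq_comm]
  obtain ⟨γ, hγ, φ, hφ⟩ := exists_functional p hp S hS ψ
  refine ⟨γ * ∏ i, c i, S.mul_mem hγ (S.prod_mem fun i _ => hc i), φ, e, fun i j => ?_⟩
  have : (if i = j then Ideal.Quotient.mk p (γ * ∏ i, c i) else 0) =
      Ideal.Quotient.mk p (if i = j then γ * ∏ i, c i else 0) := by
    split_ifs <;> simp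
  rw [this, hφ, hψ]
  split_ifs <;> simp [Algebra.smul_def]

lemma exists_dual_family_of_polynomial [Module.Finite A M] (π : A →+* R[X])
    (hC : ∀ c, C c ∈ π.range) {σ₀ : R} (hσ₀ : σ₀ ≠ 0)
    (hπ : ∀ f : R[X], ∃ n : ℕ, C (σ₀ ^ n) * f ∈ π.range) (p : Ideal A) [p.IsPrime]
    (hp : RingHom.ker π = p) {r : ℕ}
    (hr : Module.finrank p.ResidueField (p.ResidueField ⊗[A] M) = r) :
    ∃ γ ∈ constantSubmonoid π, ∃ (φ : Fin r → M →ₗ[A] A ⧸ p) (e : Fin r → M),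
      ∀ i j, φ i (e j) = if i = j then Ideal.Quotient.mk p γ else 0 := by
  let f : A →+* (FractionRing R)[X] := (mapRingHom (algebraMap R (FractionRing R))).comp π
  let : Algebra A (FractionRing R)[X] := f.toAlgebra
  have hinj : Function.Injective (mapRingHom (algebraMap R (FractionRing R))) :=
    map_injective _ (IsFractionRing.injective R (FractionRing R))
  refine exists_dual_family (L := (FractionRing R)[X]) p ?_ (constantSubmonoid π) (fun l => ?_) hr
  · rw [← hp]
    ext a
    exact map_eq_zero_iff _ hinj
  · obtain ⟨c, hc, g, hg⟩ := Localization.exists_C_mul_mem_range (nonZeroDivisors R) l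
    obtain ⟨n, a, ha⟩ := hπ g
    obtain ⟨b, hb⟩ := hC (σ₀ ^ n * c)
    refine ⟨b, mem_constantSubmonoid.2 ⟨_, mul_ne_zero (pow_ne_zero _ hσ₀)
      (nonZeroDivisors.ne_zero hc), hb⟩, a, ?_⟩
    change mapRingHom _ (π a) = mapRingHom _ (π b) * l
    rw [ha, hb, map_mul, map_mul, map_mul, hg, coe_mapRingHom, map_C, map_C, mul_assoc]


/-- After adding a suitable multiple of `s`, an element of `M` becomes nonzero in all fibres at
primes that contain `ker π` but not `s`. -/
theorem exists_one_tmul_add_smul_ne_zero [IsNoetherianRing R] [Module.Finite A M]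
    (π : A →+* R[X]) (hC : ∀ c, C c ∈ π.range) {σ₀ : R}
    (hσ₀ : σ₀ ≠ 0) (hπ : ∀ f : R[X], ∃ n : ℕ, C (σ₀ ^ n) * f ∈ π.range) (p : Ideal A) [p.IsPrime]
    (hp : RingHom.ker π = p)
    (hdim : ringKrullDim (A ⧸ p) ≤ Module.finrank p.ResidueField (p.ResidueField ⊗[A] M)) :
    ∃ c : R, c ≠ 0 ∧ ∀ (s : A) (σ : R), π s = C σ → σ ≠ 0 → c ∣ σ → ∀ x : M, ∃ y : M,
      ∀ (P : Ideal A) [P.IsPrime], p ≤ P → s ∉ P → (1 : P.ResidueField) ⊗ₜ[A] (x + s • y) ≠ 0 := by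
  obtain ⟨γ, hγ, φ, e, hφ⟩ := exists_dual_family_of_polynomial π hC hσ₀ hπ p hp (M := M) rfl
  obtain ⟨c, hc, hγc⟩ := mem_constantSubmonoid.1 hγ
  refine ⟨c * σ₀, mul_ne_zero hc hσ₀, fun s σ hs hσ hdvd x => ?_⟩
  obtain ⟨u, rfl⟩ := hdvd
  obtain ⟨υ, hυ⟩ := hC (σ₀ * u)
  choose α hα using fun i => Ideal.Quotient.mk_surjective (φ i x)
  have hA : ∀ f : R[X], ∃ n : ℕ, C ((c * σ₀ * u) ^ n) * f ∈ π.range := fun f => by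
    obtain ⟨n, hn⟩ := hπ f
    refine ⟨n, ?_⟩
    have : C ((c * σ₀ * u) ^ n) * f = C ((c * u) ^ n) * (C (σ₀ ^ n) * f) := by
      rw [← mul_assoc, ← C_mul, ← mul_pow]
      ring_nf
    rw [this]
    exact π.range.mul_mem (hC _) hn
  have hr := ringKrullDim_add_one_le_quotient_ker π hC hσ₀ hπ
  rw [hp] at hr
  obtain ⟨a, ha, n, hn⟩ := exists_row π.range hC hσ hA (hr.trans hdim) 2 (fun i => π (α i))
    fun i => ⟨_, rfl⟩
  choose b hb hab using ha
  choose β hβ using hb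
  refine ⟨∑ i, (υ * β i) • e i, fun P _ hP hsP h0 => hsP ?_⟩
  have hφx : ∀ i, φ i (x + s • ∑ j, (υ * β j) • e j) =
      Ideal.Quotient.mk p (α i + s * (υ * β i * γ)) := fun i => by
    simp only [map_add, map_smul, map_sum, hφ, hα, smul_ite, smul_zero, Finset.sum_ite_eq,
      Finset.mem_univ, if_true]
    simp [Algebra.smul_def]
  have hmem : ∀ i, α i + s * (υ * β i * γ) ∈ P := fun i => by
    have := fiberFunctional_one_tmul hP (φ i) (hφx i)
    rw [h0, map_zero] at this
    exact (Ideal.algebraMap_residueField_eq_zero).1 this.symm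
  have hπa : ∀ i, π (α i + s * (υ * β i * γ)) = a i := fun i => by
    rw [hab]
    simp only [map_add, map_mul, hs, hυ, hβ, hγc, C_pow]
    ring
  obtain ⟨g, hg⟩ := (Ideal.mem_span_range_iff_exists_fun).1 hn
  choose m hm using fun i => hA (g i)
  choose h hh using hm
  have hkey : π (s ^ (n + ∑ i, m i)) =
      π (∑ i, s ^ (∑ j ∈ Finset.univ.erase i, m j) * h i * (α i + s * (υ * β i * γ))) := by
    rw [map_sum, pow_add, map_mul, map_pow, hs, ← C_pow, ← hg, Finset.sum_mul]
    refine Finset.sum_congr rfl fun i _ => ?_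
    rw [map_mul, map_mul, hπa, hh, map_pow, map_pow, hs,
      ← Finset.sum_erase_add _ _ (Finset.mem_univ i), pow_add, C_pow]
    ring
  have hker := hP (hp.le ((RingHom.sub_mem_ker_iff π).2 hkey))
  have hsum : ∑ i, s ^ (∑ j ∈ Finset.univ.erase i, m j) * h i * (α i + s * (υ * β i * γ)) ∈ P :=
    P.sum_mem fun i _ => P.mul_mem_left _ (hmem i)
  exact ‹P.IsPrime›.mem_of_pow_mem _ ((P.sub_mem_iff_left hsum).1 hker)

end Core

section Assembly

lemma ringKrullDim_quotient_add_one_le_of_lt {A : Type*} [CommRing A] {P Q : Ideal A} [P.IsPrime]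
    (h : P < Q) : ringKrullDim (A ⧸ Q) + 1 ≤ ringKrullDim (A ⧸ P) := by
  obtain ⟨r, hrQ, hrP⟩ := SetLike.exists_of_lt h
  refine ringKrullDim_succ_le_of_surjective (Ideal.Quotient.factor h.le)
    (Ideal.Quotient.factor_surjective h.le) (r := Ideal.Quotient.mk P r)
    (mem_nonZeroDivisors_of_ne_zero fun h0 => hrP (Ideal.Quotient.eq_zero_iff_mem.1 h0)) ?_
  rw [Ideal.Quotient.factor_mk]
  exact Ideal.Quotient.eq_zero_iff_mem.2 hrQ

lemma exists_ringKrullDim_quotient_eq {A : Type*} [CommRing A] {n : ℕ}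
    (h : ringKrullDim A ≤ n) (P : PrimeSpectrum A) :
    ∃ m : ℕ, ringKrullDim (A ⧸ P.asIdeal) = m := by
  have h₁ := (ringKrullDim_quotient_le P.asIdeal).trans h
  have h₀ : 0 ≤ ringKrullDim (A ⧸ P.asIdeal) := ringKrullDim_nonneg_of_nontrivial
  generalize ringKrullDim (A ⧸ P.asIdeal) = x at h₀ h₁
  induction x with
  | bot => simp at h₀
  | coe x =>
    induction x with
    | top => exact absurd h₁ (by exact_mod_cast (ENat.natCast_lt_top n).not_ge)
    | coe x => exact ⟨x, rfl⟩

lemma exists_forall_mem_notMem_of_minimalPrimes {R : Type*} [CommRing R] [IsNoetherianRing R]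
    (q : minimalPrimes R) : ∃ t, t ∉ q.1 ∧ ∀ q' : minimalPrimes R, q' ≠ q → t ∈ q'.1 := by
  classical
  have : Finite (minimalPrimes R) := (minimalPrimes.finite_of_isNoetherianRing R).to_subtype
  have := Fintype.ofFinite (minimalPrimes R)
  have hq : q.1.IsPrime := q.2.1.1
  have hex : ∀ q' : minimalPrimes R, ∃ t, t ∉ q.1 ∧ (q' ≠ q → t ∈ q'.1) := fun q' => by
    by_cases h : q' = q
    · exact ⟨1, hq.one_notMem, fun h' => (h' h).elim⟩
    · have : ¬ q'.1 ≤ q.1 := fun hle => h (Subtype.ext (le_antisymm hle (q.2.2 q'.2.1 hle)))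
      obtain ⟨t, ht, ht'⟩ := SetLike.not_le_iff_exists.1 this
      exact ⟨t, ht', fun _ => ht⟩
  choose t ht ht' using hex
  refine ⟨∏ q', t q', fun h => ?_, fun q' hne => ?_⟩
  · obtain ⟨q', _, h'⟩ := hq.prod_mem_iff.1 h
    exact ht q' h'
  · exact Ideal.mem_of_dvd _ (Finset.dvd_prod_of_mem t (Finset.mem_univ q')) (ht' q' hne)

lemma one_tmul_smul_eq_zero {A M : Type*} [CommRing A] [AddCommGroup M] [Module A M] {P : Ideal A}
    [P.IsPrime] {s : A} (hs : s ∈ P) (y : M) : (1 : P.ResidueField) ⊗ₜ[A] (s • y) = 0 := by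
  rw [← TensorProduct.smul_tmul, Algebra.smul_def, Ideal.algebraMap_residueField_eq_zero.2 hs,
    zero_mul, TensorProduct.zero_tmul]

variable {R : Type*} [CommRing R] (A : Subalgebra R R[X])

/-- Reduction modulo `q` of the polynomials in `A`. -/
noncomputable def reduction (q : Ideal R) : A →+* (R ⧸ q)[X] :=
  (mapRingHom (Ideal.Quotient.mk q)).comp A.val.toRingHom

variable {A}

lemma reduction_algebraMap (q : Ideal R) (c : R) :
    reduction A q (algebraMap R A c) = C (Ideal.Quotient.mk q c) := by
  change map _ (algebraMap R R[X] c) = _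
  rw [Polynomial.algebraMap_apply, Algebra.algebraMap_self_apply, map_C]

lemma C_mem_range_reduction (q : Ideal R) (c : R ⧸ q) : C c ∈ (reduction A q).range := by
  obtain ⟨c, rfl⟩ := Ideal.Quotient.mk_surjective c
  exact ⟨_, reduction_algebraMap q c⟩

lemma algebraMap_mem_ker_reduction {q : Ideal R} {c : R} :
    algebraMap R A c ∈ RingHom.ker (reduction A q) ↔ c ∈ q := by
  rw [RingHom.mem_ker, reduction_algebraMap, C_eq_zero, Ideal.Quotient.eq_zero_iff_mem]

lemma exists_mul_mem_range_reduction {s : R} (hA : ∀ f : R[X], ∃ k : ℕ, C s ^ k * f ∈ A)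
    (q : Ideal R) (f : (R ⧸ q)[X]) :
    ∃ n : ℕ, C (Ideal.Quotient.mk q s ^ n) * f ∈ (reduction A q).range := by
  obtain ⟨f, rfl⟩ := map_surjective _ Ideal.Quotient.mk_surjective f
  obtain ⟨n, hn⟩ := hA f
  refine ⟨n, ⟨_, hn⟩, ?_⟩
  change map _ (C s ^ n * f) = _
  simp

lemma ker_reduction_le {s : R} (hA : ∀ f : R[X], ∃ k : ℕ, C s ^ k * f ∈ A) {q : Ideal R}
    {P : Ideal A} [P.IsPrime] (hs : algebraMap R A s ∉ P)
    (hq : q ≤ P.comap (algebraMap R A)) : RingHom.ker (reduction A q) ≤ P := by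
  intro f hf
  have hcoeff : (f : R[X]) ∈ q.map (C : R →+* R[X]) := by
    rw [← Ideal.mk_ker (I := q), ← Polynomial.ker_mapRingHom]
    exact hf
  have hclear : ∀ g ∈ q.map (C : R →+* R[X]), ∃ k : ℕ, ∃ h ∈ P, (h : R[X]) = C s ^ k * g := by
    intro g hg
    induction hg using Submodule.span_induction with
    | mem g hg =>
      obtain ⟨c, hc, rfl⟩ := hg
      exact ⟨0, algebraMap R A c, hq hc, by simp⟩
    | zero => exact ⟨0, 0, P.zero_mem, by simp⟩
    | add g g' _ _ h h' =>
      obtain ⟨k, h, hP, hh⟩ := h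
      obtain ⟨k', h', hP', hh'⟩ := h'
      refine ⟨k + k', algebraMap R A s ^ k' * h + algebraMap R A s ^ k * h',
        P.add_mem (P.mul_mem_left _ hP) (P.mul_mem_left _ hP'), ?_⟩
      push_cast
      rw [hh, hh', Polynomial.algebraMap_eq, pow_add]
      ring
    | smul a g _ h =>
      obtain ⟨k, h, hP, hh⟩ := h
      obtain ⟨k', hk'⟩ := hA a
      refine ⟨k' + k, ⟨_, hk'⟩ * h, P.mul_mem_left _ hP, ?_⟩
      push_cast
      rw [hh, smul_eq_mul, pow_add]
      ring
  obtain ⟨k, h, hP, hh⟩ := hclear _ hcoeff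
  have : h = algebraMap R A s ^ k * f := Subtype.ext (by
    push_cast
    rw [hh, Polynomial.algebraMap_eq])
  rw [this] at hP
  exact (‹P.IsPrime›.mem_or_mem hP).resolve_left fun h' => hs (‹P.IsPrime›.mem_of_pow_mem _ h')

lemma exists_ker_reduction_le {s : R} (hs : s ∈ nonZeroDivisors R)
    (hA : ∀ f : R[X], ∃ k : ℕ, C s ^ k * f ∈ A) (P : Ideal A) [P.IsPrime] :
    ∃ q ∈ minimalPrimes R, RingHom.ker (reduction A q) ≤ P := by
  obtain ⟨p, hp, hpP⟩ := Ideal.exists_minimalPrimes_le (bot_le : ⊥ ≤ P)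
  have := hp.1.1
  have hsA : algebraMap R A s ∈ nonZeroDivisors A := by
    refine mem_nonZeroDivisors_iff_right.2 fun x hx => Subtype.ext ?_
    have h0 : (x : R[X]) * C s = 0 := congrArg Subtype.val hx
    ext i
    have := congrArg (coeff · i) h0
    simp only [coeff_mul_C, coeff_zero] at this
    exact mem_nonZeroDivisors_iff_right.1 hs _ this
  have hsp : algebraMap R A s ∉ p := fun h =>
    Set.disjoint_left.1 (Ideal.disjoint_nonZeroDivisors_of_mem_minimalPrimes hp) h hsA
  obtain ⟨q, hq, hqp⟩ := Ideal.exists_minimalPrimes_le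
    (bot_le : ⊥ ≤ p.comap (algebraMap R A))
  exact ⟨q, hq, (ker_reduction_le hA hsp hqp).trans hpP⟩

lemma ker_reduction_mem_minimalPrimes {s : R} (hs : s ∈ nonZeroDivisors R)
    (hA : ∀ f : R[X], ∃ k : ℕ, C s ^ k * f ∈ A) {q : Ideal R} (hq : q ∈ minimalPrimes R) :
    RingHom.ker (reduction A q) ∈ minimalPrimes A := by
  have := hq.1.1
  refine ⟨⟨RingHom.ker_isPrime _, bot_le⟩, fun P hP hle => ?_⟩
  have := hP.1
  obtain ⟨q', hq', h⟩ := exists_ker_reduction_le hs hA P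
  have hqq : q' ≤ q := fun c hc => algebraMap_mem_ker_reduction.1
    (hle (h (algebraMap_mem_ker_reduction.2 hc)))
  obtain rfl : q' = q := le_antisymm hqq (hq.2 hq'.1 hqq)
  exact h

end Assembly

theorem stmt_0 {R : Type*} [CommRing R] [IsNoetherianRing R] (d : ℕ) (hd : 1 ≤ d)
    (hdim : ringKrullDim R = (d : ℕ))
    (A : Subalgebra R (Polynomial R)) (hA : IsGeometricSubring A d)
    (M : Type*) [AddCommGroup M] [Module A M] [Module.Finite A M]
    (hmu : ∀ (p : Ideal A) (hp : p.IsPrime), p ∈ minimalPrimes A →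
      ringKrullDim (A ⧸ p) ≤ (muP p hp M : WithBot ℕ∞)) :
    ∃ x : M, ∀ (p : Ideal A) (hp : p.IsPrime), IsBasicAt x p hp := by
  classical
  obtain ⟨hNoeth, ⟨s₀, hs₀, hA₀⟩, hdimA⟩ := hA
  have : Finite (minimalPrimes R) := (minimalPrimes.finite_of_isNoetherianRing R).to_subtype
  have := Fintype.ofFinite (minimalPrimes R)
  have hprime (q : minimalPrimes R) : q.1.IsPrime := q.2.1.1
  have hkerprime (q : minimalPrimes R) : (RingHom.ker (reduction A q.1)).IsPrime :=
    RingHom.ker_isPrime _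
  have hrank (q : minimalPrimes R) : ringKrullDim (A ⧸ RingHom.ker (reduction A q.1)) ≤
      Module.finrank (RingHom.ker (reduction A q.1)).ResidueField
        ((RingHom.ker (reduction A q.1)).ResidueField ⊗[A] M) := by
    refine (hmu _ (hkerprime q) (ker_reduction_mem_minimalPrimes hs₀ hA₀ q.2)).trans ?_
    exact_mod_cast muP_le_finrank (M := M) _ (hkerprime q)
  have hcore (q : minimalPrimes R) : ∃ s : R, s ∉ q.1 ∧
      (∀ q' : minimalPrimes R, q' ≠ q → s ∈ q'.1) ∧ ∀ x : M, ∃ y : M, ∀ (P : Ideal A) [P.IsPrime],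
        RingHom.ker (reduction A q.1) ≤ P → algebraMap R A s ∉ P →
          (1 : P.ResidueField) ⊗ₜ[A] (x + algebraMap R A s • y) ≠ 0 := by
    have hs₀q : Ideal.Quotient.mk q.1 s₀ ≠ 0 := fun h =>
      Set.disjoint_left.1 (Ideal.disjoint_nonZeroDivisors_of_mem_minimalPrimes q.2)
        (Ideal.Quotient.eq_zero_iff_mem.1 h) hs₀
    obtain ⟨c, hc, h⟩ := exists_one_tmul_add_smul_ne_zero (M := M) (reduction A q.1)
      (C_mem_range_reduction q.1) hs₀q (exists_mul_mem_range_reduction hA₀ q.1) _ rfl (hrank q)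
    obtain ⟨c, rfl⟩ := Ideal.Quotient.mk_surjective c
    obtain ⟨t, ht, ht'⟩ := exists_forall_mem_notMem_of_minimalPrimes q
    have hct : c * t ∉ q.1 := fun hmem => ((hprime q).mem_or_mem hmem).elim
      (fun h' => hc (Ideal.Quotient.eq_zero_iff_mem.2 h')) ht
    refine ⟨c * t, hct, fun q' hq' => Ideal.mul_mem_left _ _ (ht' q' hq'), ?_⟩
    exact h _ _ (reduction_algebraMap q.1 _)
      (fun h0 => hct (Ideal.Quotient.eq_zero_iff_mem.1 h0)) (map_dvd _ (dvd_mul_right c t))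
  choose s hsq hsq' hs using hcore
  let I : Ideal A := Ideal.span (Set.range fun q => algebraMap R A (s q))
  choose δ hδ using exists_ringKrullDim_quotient_eq hdimA.le
  have hδ_lt {P Q : PrimeSpectrum A} (h : P < Q) : δ Q + 1 ≤ δ P := by
    have := ringKrullDim_quotient_add_one_le_of_lt (P := P.asIdeal) (Q := Q.asIdeal) h
    rw [hδ, hδ] at this
    exact_mod_cast this
  obtain ⟨x, hx⟩ := exists_one_tmul_ne_zero (M := M) I δ (fun P Q h => hδ_lt h) (fun P hP => by
    obtain ⟨q, hq, hqP⟩ := exists_ker_reduction_le hs₀ hA₀ P.asIdeal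
    let p : PrimeSpectrum A := ⟨_, hkerprime ⟨q, hq⟩⟩
    have hpP : p < P := lt_of_le_of_ne hqP fun h => hsq ⟨q, hq⟩ <|
      algebraMap_mem_ker_reduction.1 (by
        change _ ∈ p.asIdeal
        rw [h]
        exact hP (Ideal.subset_span ⟨⟨q, hq⟩, rfl⟩))
    have hp := hrank ⟨q, hq⟩
    have : (RingHom.ker (reduction A q)).IsPrime := hkerprime ⟨q, hq⟩
    rw [hδ p] at hp
    exact (hδ_lt hpP).trans ((by exact_mod_cast hp : δ p ≤ _).trans (finrank_fiber_le_of_le hqP)))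
  choose y hy using fun q => hs q x
  refine ⟨x + ∑ q, algebraMap R A (s q) • y q, fun P hP => isBasicAt_of_one_tmul_ne_zero P hP ?_⟩
  by_cases hall : ∀ q, algebraMap R A (s q) ∈ P
  · rw [TensorProduct.tmul_add, TensorProduct.tmul_sum,
      Finset.sum_eq_zero fun q _ => one_tmul_smul_eq_zero (hall q) _, add_zero]
    exact hx ⟨P, hP⟩ (Ideal.span_le.2 (Set.range_subset_iff.2 hall))
  · obtain ⟨q, hq⟩ := not_forall.1 hall
    obtain ⟨q', hq', hle⟩ := exists_ker_reduction_le hs₀ hA₀ P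
    obtain rfl : ⟨q', hq'⟩ = q := by
      by_contra hne
      exact hq (hle (algebraMap_mem_ker_reduction.2 (hsq' q _ hne)))
    have hother (q : minimalPrimes R) (hne : q ≠ ⟨q', hq'⟩) : algebraMap R A (s q) ∈ P :=
      hle (algebraMap_mem_ker_reduction.2 (hsq' q _ hne.symm))
    rw [← Finset.add_sum_erase _ _ (Finset.mem_univ (⟨q', hq'⟩ : minimalPrimes R)), ← add_assoc,
      TensorProduct.tmul_add, TensorProduct.tmul_sum, Finset.sum_eq_zero fun q hq => ?_, add_zero]
    · exact hy _ P hle hq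
    · exact one_tmul_smul_eq_zero (hother q (Finset.ne_of_mem_erase hq)) _
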